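/- Let d ≥ 1 and α > 0. For all M, B > 0 there exists a constant C = C(d, α, M, B) > 0 with the following property: for all probability measures μ, ν on ℝᵈ with finite second moments satisfying M₂(μ) ≤ M, M₂(ν) ≤ M, ‖b(μ)‖ < B and ‖b(ν)‖ < B, if ρ_μ and ρ_ν denote the unique minimizers of F_μ and F_ν respectively over probability measures with finite first moment, then W₂(ρ_μ, ρ_ν) ≤ C · W₂(μ, ν)^{1/2}. -/

import Mathlib

open MeasureTheory ENNReal
open scoped RealInnerProductSpace

noncomputable section

/-- Euclidean space `ℝᵈ`. -/
abbrev Ed (d : ℕ) := EuclideanSpace ℝ (Fin d)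

/-- The positive part of an extended real number, as an element of `ℝ≥0∞`. -/
noncomputable def EReal.posPart (a : EReal) : ℝ≥0∞ :=
  if a = ⊤ then ⊤ else ENNReal.ofReal a.toReal

/-- Signed integral (with values in `EReal`) of a real-valued function. -/
noncomputable def sInt {α : Type*} [MeasurableSpace α] (ν : Measure α) (g : α → ℝ) : EReal :=
  ((∫⁻ x, ENNReal.ofReal (g x) ∂ν : ℝ≥0∞) : EReal) -
    ((∫⁻ x, ENNReal.ofReal (-(g x)) ∂ν : ℝ≥0∞) : EReal)

/-- Signed integral (with values in `EReal`) of an `EReal`-valued function. -/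
noncomputable def eInt {α : Type*} [MeasurableSpace α] (ν : Measure α) (f : α → EReal) : EReal :=
  ((∫⁻ x, (f x).posPart ∂ν : ℝ≥0∞) : EReal) - ((∫⁻ x, (-(f x)).posPart ∂ν : ℝ≥0∞) : EReal)

/-- The set of couplings (transport plans) between two measures on `ℝᵈ`. -/
def couplings {d : ℕ} (ρ μ : Measure (Ed d)) : Set (Measure (Ed d × Ed d)) :=
  {γ | IsProbabilityMeasure γ ∧ γ.map Prod.fst = ρ ∧ γ.map Prod.snd = μ}

/-- The maximal correlation functional `T(ρ, μ)`. -/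
noncomputable def maxCorr {d : ℕ} (ρ μ : Measure (Ed d)) : EReal :=
  ⨆ γ ∈ couplings ρ μ, sInt γ (fun p => ⟪p.1, p.2⟫)

/-- The entropy `E(ρ)` of a measure with respect to Lebesgue measure. -/
noncomputable def Ent {d : ℕ} (ρ : Measure (Ed d)) : EReal := by
  classical
  exact if _h : ρ ≪ (volume : Measure (Ed d)) then
    sInt (volume : Measure (Ed d))
      (fun x => (ρ.rnDeriv volume x).toReal * Real.log (ρ.rnDeriv volume x).toReal)
  else ⊤

/-- The second moment of a measure, with values in `ℝ≥0∞`. -/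
noncomputable def M2e {d : ℕ} (ρ : Measure (Ed d)) : ℝ≥0∞ :=
  ∫⁻ x, ENNReal.ofReal (‖x‖ ^ 2) ∂ρ

/-- The regularized functional `F_μ(ρ) = E(ρ) + T(ρ, μ) + (α/2) M₂(ρ)`. -/
noncomputable def Ffun {d : ℕ} (α : ℝ) (μ ρ : Measure (Ed d)) : EReal :=
  Ent ρ + maxCorr ρ μ + ((α / 2 : ℝ) : EReal) * ((M2e ρ : ℝ≥0∞) : EReal)

/-- The `p`-th moment `M_p(ρ) = ∫ ‖x‖^p dρ`. -/
noncomputable def Mp {d : ℕ} (p : ℝ) (ρ : Measure (Ed d)) : ℝ :=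
  ∫ x, ‖x‖ ^ p ∂ρ

/-- The barycenter `b(ρ) = ∫ x dρ`. -/
noncomputable def bary {d : ℕ} (ρ : Measure (Ed d)) : Ed d :=
  ∫ x, x ∂ρ

/-- Probability measures on `ℝᵈ` with finite first moment. -/
def P1 (d : ℕ) : Set (Measure (Ed d)) :=
  {ρ | IsProbabilityMeasure ρ ∧ Integrable (fun x => ‖x‖) ρ}

/-- Probability measures on `ℝᵈ` with finite second moment. -/
def P2 (d : ℕ) : Set (Measure (Ed d)) :=
  {ρ | IsProbabilityMeasure ρ ∧ Integrable (fun x => ‖x‖ ^ 2) ρ}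

/-- `ρ` is a minimizer of `F_μ` over probability measures with finite first moment. -/
def IsMinOfF {d : ℕ} (α : ℝ) (μ ρ : Measure (Ed d)) : Prop :=
  ρ ∈ P1 d ∧ ∀ σ ∈ P1 d, Ffun α μ ρ ≤ Ffun α μ σ

/-- The 2-Wasserstein distance between two measures on `ℝᵈ`. -/
noncomputable def W2 {d : ℕ} (ρ μ : Measure (Ed d)) : ℝ :=
  Real.sqrt ((⨅ γ ∈ couplings ρ μ, ∫⁻ p, ENNReal.ofReal (‖p.1 - p.2‖ ^ 2) ∂γ).toReal)

/-- Convexity of an `EReal`-valued function on `ℝᵈ`. -/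
def EConvexOn {d : ℕ} (u : Ed d → EReal) : Prop :=
  ∀ x y : Ed d, ∀ s t : ℝ, 0 ≤ s → 0 ≤ t → s + t = 1 →
    u (s • x + t • y) ≤ (s : EReal) * u x + (t : EReal) * u y

/-- The Legendre transform `u*(y) = sup_x (⟨x, y⟩ - u(x))` of an `EReal`-valued function. -/
noncomputable def legendre {d : ℕ} (u : Ed d → EReal) : Ed d → EReal :=
  fun y => ⨆ x : Ed d, (((⟪x, y⟫ : ℝ) : EReal) - u x)

/-- The Gaussian-regularized density `exp(-u(x) - (α/2)‖x‖²)`, with value `0` where `u = ⊤`. -/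
noncomputable def gdens {d : ℕ} (α : ℝ) (u : Ed d → EReal) (x : Ed d) : ℝ≥0∞ :=
  if u x = ⊤ then 0 else ENNReal.ofReal (Real.exp (-(u x).toReal - (α / 2) * ‖x‖ ^ 2))

open ProbabilityTheory in
/-- Gluing lemma: a probability measure `P` can be extended so that the pair of a given random
variable `Y` and the new coordinate has a prescribed law `η`. -/
theorem exists_gluing {X Y Z : Type*} [MeasurableSpace X] [MeasurableSpace Y] [MeasurableSpace Z]
    [StandardBorelSpace Z] [Nonempty Z] (P : Measure X) {f : X → Y} (hf : Measurable f)
    (η : Measure (Y × Z)) [IsProbabilityMeasure P] [IsProbabilityMeasure η]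
    (h : P.map f = η.map Prod.fst) :
    ∃ Θ : Measure (X × Z), IsProbabilityMeasure Θ ∧ Θ.map Prod.fst = P ∧
      Θ.map (fun p => (f p.1, p.2)) = η := by
  let κ : Kernel X Z := η.condKernel.comap f hf
  refine ⟨P ⊗ₘ κ, inferInstance, Measure.fst_compProd P κ, ?_⟩
  have hf' : Measurable (fun p : X × Z => (f p.1, p.2)) := by fun_prop
  conv_rhs => rw [← η.disintegrate η.condKernel]
  ext s hs
  rw [Measure.map_apply hf' hs, Measure.compProd_apply (hf' hs), Measure.compProd_apply hs,
    Measure.fst, ← h, lintegral_map (Kernel.measurable_kernel_prodMk_left hs) hf]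
  rfl

theorem sInt_of_integrable {α : Type*} [MeasurableSpace α] {ν : Measure α} {g : α → ℝ}
    (hg : Integrable g ν) : sInt ν g = ((∫ x, g x ∂ν : ℝ) : EReal) := by
  have h1 : ∫⁻ x, ENNReal.ofReal (g x) ∂ν ≠ ⊤ := hg.lintegral_lt_top.ne
  have h2 : ∫⁻ x, ENNReal.ofReal (-(g x)) ∂ν ≠ ⊤ := hg.neg.lintegral_lt_top.ne
  rw [sInt, integral_eq_lintegral_pos_part_sub_lintegral_neg_part hg, EReal.coe_sub,
    EReal.coe_ennreal_toReal h1, EReal.coe_ennreal_toReal h2]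

section Moments

variable {d : ℕ} {Ω : Type*} [MeasurableSpace Ω] {P : Measure Ω}

/-- The second moment as a real number. -/
def m2 (ρ : Measure (Ed d)) : ℝ := ∫ x, ‖x‖ ^ 2 ∂ρ

theorem m2_nonneg (ρ : Measure (Ed d)) : 0 ≤ m2 ρ := integral_nonneg fun _ => by positivity

theorem Mp_two (ρ : Measure (Ed d)) : Mp 2 ρ = m2 ρ := by simp [Mp, m2]

theorem integral_norm_sq_map {X : Ω → Ed d} (hX : Measurable X) :
    m2 (P.map X) = ∫ ω, ‖X ω‖ ^ 2 ∂P := by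
  rw [m2, integral_map hX.aemeasurable (by fun_prop)]

theorem memLp_of_mem_P2 {X : Ω → Ed d} (hX : Measurable X) (h : P.map X ∈ P2 d) :
    MemLp X 2 P := by
  rw [memLp_two_iff_integrable_sq_norm hX.aestronglyMeasurable]
  exact (integrable_map_measure (by fun_prop) hX.aemeasurable).1 h.2

theorem integrable_inner_of_memLp {X Y : Ω → Ed d} (hX : MemLp X 2 P) (hY : MemLp Y 2 P) :
    Integrable (fun ω => ⟪X ω, Y ω⟫) P := by
  refine ((hX.integrable_norm_pow (by norm_num)).add (hY.integrable_norm_pow (by norm_num))).mono'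
    (hX.1.inner hY.1) (ae_of_all _ fun ω => ?_)
  have := abs_real_inner_le_norm (X ω) (Y ω)
  simp only [Real.norm_eq_abs, Pi.add_apply]
  nlinarith [sq_nonneg (‖X ω‖ - ‖Y ω‖), sq_nonneg ‖X ω‖, sq_nonneg ‖Y ω‖]

/-- Cauchy–Schwarz for vector valued square integrable random variables. -/
theorem integral_inner_le_sqrt {X Y : Ω → Ed d} (hX : MemLp X 2 P) (hY : MemLp Y 2 P) :
    ∫ ω, ⟪X ω, Y ω⟫ ∂P ≤ Real.sqrt (∫ ω, ‖X ω‖ ^ 2 ∂P) * Real.sqrt (∫ ω, ‖Y ω‖ ^ 2 ∂P) := by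
  set a := ∫ ω, ‖X ω‖ ^ 2 ∂P
  set b := ∫ ω, ‖Y ω‖ ^ 2 ∂P
  set c := ∫ ω, ⟪X ω, Y ω⟫ ∂P with hc
  have ha : 0 ≤ a := integral_nonneg fun _ => by positivity
  have hb : 0 ≤ b := integral_nonneg fun _ => by positivity
  have iX := hX.integrable_norm_pow (p := 2) (by norm_num)
  have iY := hY.integrable_norm_pow (p := 2) (by norm_num)
  have iXY := integrable_inner_of_memLp hX hY
  have key : ∀ t : ℝ, 0 ≤ a * (t * t) + (2 * c) * t + b := by
    intro t
    have h : 0 ≤ ∫ ω, ‖t • X ω + Y ω‖ ^ 2 ∂P := integral_nonneg fun _ => by positivity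
    have e : (fun ω => ‖t • X ω + Y ω‖ ^ 2) =
        fun ω => (t * t) * ‖X ω‖ ^ 2 + (2 * t) * ⟪X ω, Y ω⟫ + ‖Y ω‖ ^ 2 := by
      funext ω
      rw [norm_add_sq_real, norm_smul, real_inner_smul_left, mul_pow, Real.norm_eq_abs, sq_abs]
      ring
    have i12 : Integrable (fun ω => (t * t) * ‖X ω‖ ^ 2 + (2 * t) * ⟪X ω, Y ω⟫) P :=
      (iX.const_mul _).add (iXY.const_mul _)
    rw [e, integral_add i12 iY,
      integral_add (iX.const_mul _) (iXY.const_mul _), integral_const_mul, integral_const_mul] at h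
    linarith
  have hd := discrim_le_zero key
  rw [discrim] at hd
  rw [← Real.sqrt_mul ha]
  exact Real.le_sqrt_of_sq_le (by nlinarith)

theorem coe_M2e {ρ : Measure (Ed d)} (h : ρ ∈ P2 d) : ((M2e ρ : ℝ≥0∞) : EReal) = (m2 ρ : ℝ) := by
  have h1 : ∫⁻ x, ENNReal.ofReal (‖x‖ ^ 2) ∂ρ ≠ ⊤ := h.2.lintegral_lt_top.ne
  rw [M2e, m2, integral_eq_lintegral_of_nonneg_ae (ae_of_all _ fun _ => by positivity) h.2.1,
    EReal.coe_ennreal_toReal h1]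

theorem P2_subset_P1 : P2 d ⊆ P1 d := by
  rintro ρ ⟨h1, h2⟩
  refine ⟨h1, ?_⟩
  have : MemLp (fun x : Ed d => x) 2 ρ :=
    (memLp_two_iff_integrable_sq_norm (by fun_prop)).2 h2
  exact (this.integrable (by norm_num)).norm

theorem memLp_fst {ρ μ : Measure (Ed d)} {γ : Measure (Ed d × Ed d)} (hγ : γ ∈ couplings ρ μ)
    (h : ρ ∈ P2 d) : MemLp Prod.fst 2 γ :=
  memLp_of_mem_P2 measurable_fst (by rwa [hγ.2.1])

theorem memLp_snd {ρ μ : Measure (Ed d)} {γ : Measure (Ed d × Ed d)} (hγ : γ ∈ couplings ρ μ)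
    (h : μ ∈ P2 d) : MemLp Prod.snd 2 γ :=
  memLp_of_mem_P2 measurable_snd (by rwa [hγ.2.2])

theorem prod_mem_couplings {ρ μ : Measure (Ed d)} [IsProbabilityMeasure ρ]
    [IsProbabilityMeasure μ] : ρ.prod μ ∈ couplings ρ μ :=
  ⟨inferInstance, by simp, by simp⟩

theorem map_mem_couplings [IsProbabilityMeasure P] {X Y : Ω → Ed d} (hX : Measurable X)
    (hY : Measurable Y) :
    P.map (fun ω => (X ω, Y ω)) ∈ couplings (P.map X) (P.map Y) := by
  have hXY : Measurable (fun ω => (X ω, Y ω)) := hX.prodMk hY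
  refine ⟨Measure.isProbabilityMeasure_map hXY.aemeasurable, ?_, ?_⟩
  · rw [Measure.map_map measurable_fst hXY]; rfl
  · rw [Measure.map_map measurable_snd hXY]; rfl

/-- The maximal correlation as a real number. -/
def corr (ρ μ : Measure (Ed d)) : ℝ := (maxCorr ρ μ).toReal

theorem sInt_inner {ρ μ : Measure (Ed d)} (hρ : ρ ∈ P2 d) (hμ : μ ∈ P2 d)
    {γ : Measure (Ed d × Ed d)} (hγ : γ ∈ couplings ρ μ) :
    sInt γ (fun p => ⟪p.1, p.2⟫) = ((∫ p, ⟪p.1, p.2⟫ ∂γ : ℝ) : EReal) :=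
  sInt_of_integrable (integrable_inner_of_memLp (memLp_fst hγ hρ) (memLp_snd hγ hμ))

theorem integral_inner_coupling_le {ρ μ : Measure (Ed d)} (hρ : ρ ∈ P2 d) (hμ : μ ∈ P2 d)
    {γ : Measure (Ed d × Ed d)} (hγ : γ ∈ couplings ρ μ) :
    ∫ p, ⟪p.1, p.2⟫ ∂γ ≤ Real.sqrt (m2 ρ) * Real.sqrt (m2 μ) := by
  refine (integral_inner_le_sqrt (memLp_fst hγ hρ) (memLp_snd hγ hμ)).trans_eq ?_
  rw [← integral_norm_sq_map measurable_fst, ← integral_norm_sq_map measurable_snd, hγ.2.1, hγ.2.2]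

theorem maxCorr_eq_corr {ρ μ : Measure (Ed d)} (hρ : ρ ∈ P2 d) (hμ : μ ∈ P2 d) :
    maxCorr ρ μ = (corr ρ μ : ℝ) := by
  have := hρ.1
  have := hμ.1
  refine (EReal.coe_toReal ?_ ?_).symm
  · refine ne_top_of_le_ne_top (EReal.coe_ne_top (Real.sqrt (m2 ρ) * Real.sqrt (m2 μ))) ?_
    refine iSup₂_le fun γ hγ => ?_
    rw [sInt_inner hρ hμ hγ]
    exact_mod_cast integral_inner_coupling_le hρ hμ hγ
  · refine ne_bot_of_le_ne_bot (EReal.coe_ne_bot (∫ p, ⟪p.1, p.2⟫ ∂(ρ.prod μ))) ?_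
    rw [← sInt_inner hρ hμ prod_mem_couplings]
    exact le_iSup₂_of_le _ prod_mem_couplings le_rfl

theorem corr_le {ρ μ : Measure (Ed d)} (hρ : ρ ∈ P2 d) (hμ : μ ∈ P2 d) {c : ℝ}
    (h : ∀ γ ∈ couplings ρ μ, ∫ p, ⟪p.1, p.2⟫ ∂γ ≤ c) : corr ρ μ ≤ c := by
  rw [← EReal.coe_le_coe_iff, ← maxCorr_eq_corr hρ hμ]
  refine iSup₂_le fun γ hγ => ?_
  rw [sInt_inner hρ hμ hγ]
  exact_mod_cast h γ hγ

theorem le_corr_of_coupling {ρ μ : Measure (Ed d)} (hρ : ρ ∈ P2 d) (hμ : μ ∈ P2 d)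
    {γ : Measure (Ed d × Ed d)} (hγ : γ ∈ couplings ρ μ) : ∫ p, ⟪p.1, p.2⟫ ∂γ ≤ corr ρ μ := by
  rw [← EReal.coe_le_coe_iff, ← maxCorr_eq_corr hρ hμ, ← sInt_inner hρ hμ hγ]
  exact le_iSup₂_of_le _ hγ le_rfl

theorem corr_le_sqrt {ρ μ : Measure (Ed d)} (hρ : ρ ∈ P2 d) (hμ : μ ∈ P2 d) :
    corr ρ μ ≤ Real.sqrt (m2 ρ) * Real.sqrt (m2 μ) :=
  corr_le hρ hμ fun _ hγ => integral_inner_coupling_le hρ hμ hγ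

theorem integral_inner_le_corr [IsProbabilityMeasure P] {ρ μ : Measure (Ed d)} (hρ : ρ ∈ P2 d)
    (hμ : μ ∈ P2 d) {X Y : Ω → Ed d} (hX : Measurable X) (hY : Measurable Y) (hXρ : P.map X = ρ)
    (hYμ : P.map Y = μ) : ∫ ω, ⟪X ω, Y ω⟫ ∂P ≤ corr ρ μ := by
  have h := map_mem_couplings (P := P) hX hY
  rw [hXρ, hYμ] at h
  have := le_corr_of_coupling hρ hμ h
  rwa [integral_map (hX.prodMk hY).aemeasurable (by fun_prop)] at this

theorem neg_le_corr {ρ μ : Measure (Ed d)} (hρ : ρ ∈ P2 d) (hμ : μ ∈ P2 d) :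
    -(Real.sqrt (m2 ρ) * Real.sqrt (m2 μ)) ≤ corr ρ μ := by
  have := hρ.1
  have := hμ.1
  have hγ : ρ.prod μ ∈ couplings ρ μ := prod_mem_couplings
  refine le_trans ?_ (le_corr_of_coupling hρ hμ hγ)
  have h := integral_inner_le_sqrt (memLp_fst hγ hρ).neg (memLp_snd hγ hμ)
  simp only [Pi.neg_apply, inner_neg_left, integral_neg, norm_neg] at h
  rw [← integral_norm_sq_map measurable_fst, ← integral_norm_sq_map measurable_snd, hγ.2.1,
    hγ.2.2] at h
  linarith

/-- Stability of the maximal correlation in its second argument. -/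
theorem corr_le_corr_add {ρ μ ν : Measure (Ed d)} (hρ : ρ ∈ P2 d) (hμ : μ ∈ P2 d)
    (hν : ν ∈ P2 d) {η : Measure (Ed d × Ed d)} (hη : η ∈ couplings μ ν) :
    corr ρ μ ≤ corr ρ ν + Real.sqrt (m2 ρ) * Real.sqrt (∫ p, ‖p.1 - p.2‖ ^ 2 ∂η) := by
  refine corr_le hρ hμ fun γ hγ => ?_
  have := hγ.1
  have := hη.1
  obtain ⟨Θ, hΘ, h1, h2⟩ := exists_gluing γ measurable_snd η (by rw [hγ.2.2, hη.2.1])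
  have hx : Θ.map (fun p => p.1.1) = ρ := by
    rw [← hγ.2.1, ← h1, Measure.map_map measurable_fst measurable_fst]; rfl
  have hy : Θ.map (fun p => p.1.2) = μ := by
    rw [← hγ.2.2, ← h1, Measure.map_map measurable_snd measurable_fst]; rfl
  have hz : Θ.map (fun p => p.2) = ν := by
    rw [← hη.2.2, ← h2, Measure.map_map measurable_snd (by fun_prop)]; rfl
  have lx : MemLp (fun p : (Ed d × Ed d) × Ed d => p.1.1) 2 Θ :=
    memLp_of_mem_P2 (by fun_prop) (by rwa [hx])
  have ly : MemLp (fun p : (Ed d × Ed d) × Ed d => p.1.2) 2 Θ :=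
    memLp_of_mem_P2 (by fun_prop) (by rwa [hy])
  have lz : MemLp (fun p : (Ed d × Ed d) × Ed d => p.2) 2 Θ :=
    memLp_of_mem_P2 (by fun_prop) (by rwa [hz])
  have e1 : ∫ p, ⟪p.1, p.2⟫ ∂γ = ∫ p, ⟪p.1.1, p.1.2⟫ ∂Θ := by
    rw [← h1, integral_map measurable_fst.aemeasurable (by fun_prop)]
  have e2 : ∫ p, ‖p.1 - p.2‖ ^ 2 ∂η = ∫ p, ‖p.1.2 - p.2‖ ^ 2 ∂Θ := by
    rw [← h2, integral_map (by fun_prop) (by fun_prop)]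
  have e3 : m2 ρ = ∫ p, ‖p.1.1‖ ^ 2 ∂Θ := by rw [← hx, integral_norm_sq_map (by fun_prop)]
  have e4 : ∫ p, ⟪p.1.1, p.1.2⟫ ∂Θ = ∫ p, ⟪p.1.1, p.2⟫ ∂Θ + ∫ p, ⟪p.1.1, p.1.2 - p.2⟫ ∂Θ := by
    have i2 : Integrable (fun p : (Ed d × Ed d) × Ed d => ⟪p.1.1, p.1.2 - p.2⟫) Θ :=
      integrable_inner_of_memLp lx (ly.sub lz)
    rw [← integral_add (integrable_inner_of_memLp lx lz) i2]
    simp only [← inner_add_right, add_sub_cancel]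
  rw [e1, e2, e3, e4]
  exact add_le_add (integral_inner_le_corr hρ hν (by fun_prop) (by fun_prop) hx hz)
    (integral_inner_le_sqrt lx (ly.sub lz))

/-- If `σ` is close to the law of the midpoint of a coupling of `ρ₀` and `ρ₁`, then its correlation
with `μ` is almost at most the mean of those of `ρ₀` and `ρ₁`. -/
theorem corr_approx_midpoint_le {ρ₀ ρ₁ σ μ : Measure (Ed d)} (h₀ : ρ₀ ∈ P2 d) (h₁ : ρ₁ ∈ P2 d)
    (hσ : σ ∈ P2 d) (hμ : μ ∈ P2 d) {Θ : Measure ((Ed d × Ed d) × Ed d)} [IsProbabilityMeasure Θ]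
    (hx : Θ.map (fun p => p.1.1) = ρ₀) (hy : Θ.map (fun p => p.1.2) = ρ₁)
    (hz : Θ.map (fun p => p.2) = σ) :
    corr σ μ ≤ (1 / 2) * corr ρ₀ μ + (1 / 2) * corr ρ₁ μ +
      Real.sqrt (∫ p, ‖p.2 - (1 / 2 : ℝ) • (p.1.1 + p.1.2)‖ ^ 2 ∂Θ) * Real.sqrt (m2 μ) := by
  refine corr_le hσ hμ fun γ hγ => ?_
  have := hγ.1
  obtain ⟨Λ, hΛ, h1, h2⟩ := exists_gluing Θ measurable_snd γ (by rw [hγ.2.1]; exact hz)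
  have kx : Λ.map (fun p => p.1.1.1) = ρ₀ := by
    rw [← hx, ← h1, Measure.map_map (by fun_prop) measurable_fst]; rfl
  have ky : Λ.map (fun p => p.1.1.2) = ρ₁ := by
    rw [← hy, ← h1, Measure.map_map (by fun_prop) measurable_fst]; rfl
  have kz : Λ.map (fun p => p.1.2) = σ := by
    rw [← hz, ← h1, Measure.map_map (by fun_prop) measurable_fst]; rfl
  have kw : Λ.map (fun p => p.2) = μ := by
    rw [← hγ.2.2, ← h2, Measure.map_map (by fun_prop) (by fun_prop)]; rfl
  have lx : MemLp (fun p : ((Ed d × Ed d) × Ed d) × Ed d => p.1.1.1) 2 Λ :=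
    memLp_of_mem_P2 (by fun_prop) (by rwa [kx])
  have ly : MemLp (fun p : ((Ed d × Ed d) × Ed d) × Ed d => p.1.1.2) 2 Λ :=
    memLp_of_mem_P2 (by fun_prop) (by rwa [ky])
  have lz : MemLp (fun p : ((Ed d × Ed d) × Ed d) × Ed d => p.1.2) 2 Λ :=
    memLp_of_mem_P2 (by fun_prop) (by rwa [kz])
  have lw : MemLp (fun p : ((Ed d × Ed d) × Ed d) × Ed d => p.2) 2 Λ :=
    memLp_of_mem_P2 (by fun_prop) (by rwa [kw])
  have lm : MemLp (fun p : ((Ed d × Ed d) × Ed d) × Ed d =>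
      p.1.2 - (1 / 2 : ℝ) • (p.1.1.1 + p.1.1.2)) 2 Λ := lz.sub ((lx.add ly).const_smul (1 / 2 : ℝ))
  have e1 : ∫ p, ⟪p.1, p.2⟫ ∂γ = ∫ p, ⟪p.1.2, p.2⟫ ∂Λ := by
    rw [← h2, integral_map (by fun_prop) (by fun_prop)]
  have e2 : ∫ p, ‖p.2 - (1 / 2 : ℝ) • (p.1.1 + p.1.2)‖ ^ 2 ∂Θ =
      ∫ p, ‖p.1.2 - (1 / 2 : ℝ) • (p.1.1.1 + p.1.1.2)‖ ^ 2 ∂Λ := by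
    rw [← h1, integral_map (by fun_prop) (by fun_prop)]
  have e3 : m2 μ = ∫ p, ‖p.2‖ ^ 2 ∂Λ := by rw [← kw, integral_norm_sq_map (by fun_prop)]
  have e4 : ∫ p, ⟪p.1.2, p.2⟫ ∂Λ = (1 / 2) * ∫ p, ⟪p.1.1.1, p.2⟫ ∂Λ +
      (1 / 2) * ∫ p, ⟪p.1.1.2, p.2⟫ ∂Λ +
      ∫ p, ⟪p.1.2 - (1 / 2 : ℝ) • (p.1.1.1 + p.1.1.2), p.2⟫ ∂Λ := by
    have i1 := integrable_inner_of_memLp lx lw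
    have i2 := integrable_inner_of_memLp ly lw
    have i3 := integrable_inner_of_memLp lm lw
    have i12 : Integrable (fun p : ((Ed d × Ed d) × Ed d) × Ed d =>
        1 / 2 * ⟪p.1.1.1, p.2⟫ + 1 / 2 * ⟪p.1.1.2, p.2⟫) Λ := (i1.const_mul _).add (i2.const_mul _)
    rw [← integral_const_mul, ← integral_const_mul, ← integral_add (i1.const_mul _)
      (i2.const_mul _), ← integral_add i12 i3]
    congr 1
    funext p
    simp only [inner_sub_left, inner_add_left, real_inner_smul_left, smul_add]
    ring
  rw [e1, e2, e3, e4]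
  have a1 := integral_inner_le_corr h₀ hμ (by fun_prop) (by fun_prop) kx kw
  have a2 := integral_inner_le_corr h₁ hμ (by fun_prop) (by fun_prop) ky kw
  have a3 := integral_inner_le_sqrt lm lw
  linarith

/-- Second moment of an approximate midpoint. -/
theorem m2_approx_midpoint_le {ρ₀ ρ₁ σ : Measure (Ed d)} (h₀ : ρ₀ ∈ P2 d) (h₁ : ρ₁ ∈ P2 d)
    (hσ : σ ∈ P2 d) {Θ : Measure ((Ed d × Ed d) × Ed d)} [IsProbabilityMeasure Θ]
    (hx : Θ.map (fun p => p.1.1) = ρ₀) (hy : Θ.map (fun p => p.1.2) = ρ₁)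
    (hz : Θ.map (fun p => p.2) = σ) :
    m2 σ ≤ (1 / 2) * m2 ρ₀ + (1 / 2) * m2 ρ₁ - (1 / 4) * ∫ p, ‖p.1.1 - p.1.2‖ ^ 2 ∂Θ +
      2 * (Real.sqrt (∫ p, ‖p.2 - (1 / 2 : ℝ) • (p.1.1 + p.1.2)‖ ^ 2 ∂Θ) * Real.sqrt (m2 σ)) := by
  have lx : MemLp (fun p : (Ed d × Ed d) × Ed d => p.1.1) 2 Θ :=
    memLp_of_mem_P2 (by fun_prop) (by rwa [hx])
  have ly : MemLp (fun p : (Ed d × Ed d) × Ed d => p.1.2) 2 Θ :=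
    memLp_of_mem_P2 (by fun_prop) (by rwa [hy])
  have lz : MemLp (fun p : (Ed d × Ed d) × Ed d => p.2) 2 Θ :=
    memLp_of_mem_P2 (by fun_prop) (by rwa [hz])
  have lm : MemLp (fun p : (Ed d × Ed d) × Ed d =>
      p.2 - (1 / 2 : ℝ) • (p.1.1 + p.1.2)) 2 Θ := lz.sub ((lx.add ly).const_smul (1 / 2 : ℝ))
  have ex : m2 ρ₀ = ∫ p, ‖p.1.1‖ ^ 2 ∂Θ := by rw [← hx, integral_norm_sq_map (by fun_prop)]
  have ey : m2 ρ₁ = ∫ p, ‖p.1.2‖ ^ 2 ∂Θ := by rw [← hy, integral_norm_sq_map (by fun_prop)]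
  have ez : m2 σ = ∫ p, ‖p.2‖ ^ 2 ∂Θ := by rw [← hz, integral_norm_sq_map (by fun_prop)]
  have hcs := integral_inner_le_sqrt lm lz
  rw [← ez] at hcs
  have ix := lx.integrable_norm_pow (p := 2) (by norm_num)
  have iy := ly.integrable_norm_pow (p := 2) (by norm_num)
  have ixy : Integrable (fun p : (Ed d × Ed d) × Ed d => ‖p.1.1 - p.1.2‖ ^ 2) Θ :=
    (lx.sub ly).integrable_norm_pow (p := 2) (by norm_num)
  have iz := lz.integrable_norm_pow (p := 2) (by norm_num)
  have imz := integrable_inner_of_memLp lm lz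
  have key : ∫ p, ‖p.2‖ ^ 2 ∂Θ ≤ ∫ p, ((1 / 2) * ‖p.1.1‖ ^ 2 + (1 / 2) * ‖p.1.2‖ ^ 2 -
      (1 / 4) * ‖p.1.1 - p.1.2‖ ^ 2 + 2 * ⟪p.2 - (1 / 2 : ℝ) • (p.1.1 + p.1.2), p.2⟫) ∂Θ := by
    refine integral_mono iz (((((ix.const_mul _).add (iy.const_mul _)).sub
      (ixy.const_mul _)).add (imz.const_mul _))) fun p => ?_
    have h1 : 0 ≤ ‖p.2 - (1 / 2 : ℝ) • (p.1.1 + p.1.2)‖ ^ 2 := by positivity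
    simp only [← real_inner_self_eq_norm_sq] at h1 ⊢
    simp only [inner_sub_left, inner_sub_right, inner_add_left, inner_add_right, smul_add,
      real_inner_smul_left, real_inner_smul_right] at h1 ⊢
    rw [real_inner_comm p.1.1 p.1.2, real_inner_comm p.1.1 p.2, real_inner_comm p.1.2 p.2] at h1
    rw [real_inner_comm p.1.1 p.1.2]
    linarith
  have i12 : Integrable (fun p : (Ed d × Ed d) × Ed d =>
      (1 / 2) * ‖p.1.1‖ ^ 2 + (1 / 2) * ‖p.1.2‖ ^ 2) Θ := (ix.const_mul _).add (iy.const_mul _)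
  have i123 : Integrable (fun p : (Ed d × Ed d) × Ed d =>
      (1 / 2) * ‖p.1.1‖ ^ 2 + (1 / 2) * ‖p.1.2‖ ^ 2 - (1 / 4) * ‖p.1.1 - p.1.2‖ ^ 2) Θ :=
    i12.sub (ixy.const_mul _)
  rw [integral_add i123 (imz.const_mul _), integral_sub i12 (ixy.const_mul _),
    integral_add (ix.const_mul _) (iy.const_mul _), integral_const_mul, integral_const_mul,
    integral_const_mul, integral_const_mul] at key
  linarith

end Moments

section Entropy

variable {d : ℕ}

/-- The entropy integrand of a measure. -/
def entFn (ρ : Measure (Ed d)) (x : Ed d) : ℝ :=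
  (ρ.rnDeriv volume x).toReal * Real.log (ρ.rnDeriv volume x).toReal

/-- The entropy of `ρ` is well-defined and finite. -/
def FiniteEnt (ρ : Measure (Ed d)) : Prop :=
  ρ ≪ (volume : Measure (Ed d)) ∧ Integrable (entFn ρ) volume

/-- The entropy as a real number. -/
def entR (ρ : Measure (Ed d)) : ℝ := ∫ x, entFn ρ x

theorem Ent_eq_entR {ρ : Measure (Ed d)} (h : FiniteEnt ρ) : Ent ρ = (entR ρ : ℝ) := by
  rw [Ent, dif_pos h.1]
  exact sInt_of_integrable h.2

theorem neg_mul_log_le {s : ℝ} (hs : 0 ≤ s) (a : ℝ) :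
    -(s * Real.log s) ≤ s * a + Real.exp (-1 - a) := by
  rcases hs.eq_or_lt with rfl | hs
  · simp only [zero_mul, neg_zero, zero_add]; positivity
  have h1 := Real.add_one_le_exp (-Real.log s - a - 1)
  have h2 : s * Real.exp (-Real.log s - a - 1) = Real.exp (-1 - a) := by
    conv_lhs => rw [← Real.exp_log hs]
    rw [← Real.exp_add, Real.log_exp]
    ring_nf
  nlinarith

theorem neg_mul_log_le_norm {s : ℝ} (hs : 0 ≤ s) (x : Ed d) :
    -(s * Real.log s) ≤ s * ((d + 1) * ‖x‖) + (1 + ‖x‖) ^ (-(d + 1 : ℝ)) := by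
  have hx : 0 < 1 + ‖x‖ := by positivity
  refine (neg_mul_log_le hs ((d + 1) * Real.log (1 + ‖x‖))).trans ?_
  have h1 : Real.log (1 + ‖x‖) ≤ ‖x‖ := by
    have := Real.log_le_sub_one_of_pos hx
    linarith
  gcongr
  rw [Real.rpow_def_of_pos hx]
  gcongr
  linarith

theorem integrable_rpow_norm :
    Integrable (fun x : Ed d => (1 + ‖x‖) ^ (-(d + 1 : ℝ))) volume :=
  integrable_one_add_norm (by simp)

theorem measurable_entFn (ρ : Measure (Ed d)) : Measurable (entFn ρ) := by
  have := (ρ.measurable_rnDeriv volume).ennreal_toReal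
  exact this.mul (Real.measurable_log.comp this)

theorem integrable_rnDeriv_mul_norm {ρ : Measure (Ed d)} [IsProbabilityMeasure ρ] (h : ρ ≪ volume)
    (hi : Integrable (fun x => ‖x‖) ρ) :
    Integrable (fun x => (ρ.rnDeriv volume x).toReal * ‖x‖) volume :=
  (integrable_rnDeriv_smul_iff h).2 hi

theorem neg_entFn_le (ρ : Measure (Ed d)) (x : Ed d) :
    -(entFn ρ x) ≤ (d + 1) * ((ρ.rnDeriv volume x).toReal * ‖x‖) + (1 + ‖x‖) ^ (-(d + 1 : ℝ)) :=
  (neg_mul_log_le_norm toReal_nonneg x).trans_eq (by ring)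

theorem lintegral_neg_entFn_ne_top {ρ : Measure (Ed d)} (hρ : ρ ∈ P1 d) (h : ρ ≪ volume) :
    ∫⁻ x, ENNReal.ofReal (-(entFn ρ x)) ≠ ⊤ := by
  have := hρ.1
  refine ne_top_of_le_ne_top ?_ (lintegral_mono fun x => ENNReal.ofReal_le_ofReal
    (neg_entFn_le ρ x))
  exact (((integrable_rnDeriv_mul_norm h hρ.2).const_mul _).add
    integrable_rpow_norm).lintegral_lt_top.ne

theorem neg_entR_le {ρ : Measure (Ed d)} (hρ : ρ ∈ P1 d) (h : FiniteEnt ρ) :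
    -entR ρ ≤ (d + 1) * ∫ x, ‖x‖ ∂ρ + ∫ x : Ed d, (1 + ‖x‖) ^ (-(d + 1 : ℝ)) := by
  have := hρ.1
  have i1 := (integrable_rnDeriv_mul_norm h.1 hρ.2).const_mul ((d : ℝ) + 1)
  have h1 := integral_mono h.2.neg (i1.add integrable_rpow_norm) (neg_entFn_le ρ)
  simp only [Pi.neg_apply, Pi.add_apply] at h1
  rw [integral_neg, integral_add i1 integrable_rpow_norm, integral_const_mul] at h1
  have h2 : ∫ x, (ρ.rnDeriv volume x).toReal * ‖x‖ = ∫ x, ‖x‖ ∂ρ := integral_rnDeriv_smul h.1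
  rwa [h2] at h1

theorem Ent_ne_bot {ρ : Measure (Ed d)} (hρ : ρ ∈ P1 d) : Ent ρ ≠ ⊥ := by
  rw [Ent]
  split_ifs with h
  · have h1 := lintegral_neg_entFn_ne_top hρ h
    rw [sInt, Ne, sub_eq_add_neg, EReal.add_eq_bot_iff, not_or]
    refine ⟨EReal.coe_ennreal_ne_bot _, ?_⟩
    rw [EReal.neg_eq_bot_iff, EReal.coe_ennreal_eq_top_iff]
    exact h1
  · exact top_ne_bot

theorem finiteEnt_of_Ent_ne_top {ρ : Measure (Ed d)} (hρ : ρ ∈ P1 d) (h : Ent ρ ≠ ⊤) :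
    FiniteEnt ρ := by
  rw [Ent] at h
  split_ifs at h with hac
  · refine ⟨hac, ?_⟩
    have h1 := lintegral_neg_entFn_ne_top hρ hac
    have h2 : ∫⁻ x, ENNReal.ofReal (entFn ρ x) ≠ ⊤ := by
      intro h2
      apply h
      change ((∫⁻ x, ENNReal.ofReal (entFn ρ x) : ℝ≥0∞) : EReal) -
        ((∫⁻ x, ENNReal.ofReal (-(entFn ρ x)) : ℝ≥0∞) : EReal) = ⊤
      rw [h2, ← EReal.coe_ennreal_toReal h1]
      exact EReal.top_sub_coe _
    refine ⟨(measurable_entFn ρ).aestronglyMeasurable, ?_⟩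
    rw [hasFiniteIntegral_iff_norm]
    have h3 : ∀ x, ENNReal.ofReal ‖entFn ρ x‖ =
        ENNReal.ofReal (entFn ρ x) + ENNReal.ofReal (-(entFn ρ x)) := by
      intro x
      rcases le_total 0 (entFn ρ x) with hx | hx
      · rw [Real.norm_of_nonneg hx, ENNReal.ofReal_of_nonpos (neg_nonpos.2 hx), add_zero]
      · rw [Real.norm_of_nonpos hx, ENNReal.ofReal_of_nonpos hx, zero_add]
    simp_rw [h3]
    rw [lintegral_add_left (measurable_entFn ρ).ennreal_ofReal]
    exact ENNReal.add_lt_top.2 ⟨h2.lt_top, h1.lt_top⟩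
  · exact absurd rfl h

theorem entFn_withDensity {h : Ed d → ℝ} (hm : Measurable h) (h0 : ∀ x, 0 ≤ h x) :
    entFn (volume.withDensity fun x => ENNReal.ofReal (h x)) =ᵐ[volume]
      fun x => h x * Real.log (h x) := by
  filter_upwards [Measure.rnDeriv_withDensity volume hm.ennreal_ofReal] with x hx
  rw [entFn, hx, ENNReal.toReal_ofReal (h0 x)]

/-- The functional `F_μ` as a real number. -/
def FR (α : ℝ) (μ ρ : Measure (Ed d)) : ℝ := entR ρ + corr ρ μ + α / 2 * m2 ρ

theorem Ffun_eq_FR {α : ℝ} {μ ρ : Measure (Ed d)} (hμ : μ ∈ P2 d) (hρ : ρ ∈ P2 d)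
    (h : FiniteEnt ρ) : Ffun α μ ρ = (FR α μ ρ : ℝ) := by
  rw [Ffun, Ent_eq_entR h, maxCorr_eq_corr hρ hμ, coe_M2e hρ, FR]
  push_cast
  rfl

theorem P2_integrable_norm {ρ : Measure (Ed d)} (hρ : ρ ∈ P2 d) : Integrable (fun x => ‖x‖) ρ :=
  (P2_subset_P1 hρ).2

theorem maxCorr_ne_bot {ρ μ : Measure (Ed d)} (hρ : ρ ∈ P1 d) (hμ : μ ∈ P2 d) :
    maxCorr ρ μ ≠ ⊥ := by
  have := hρ.1
  have := hμ.1
  have hi : Integrable (fun p : Ed d × Ed d => ⟪p.1, p.2⟫) (ρ.prod μ) := by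
    refine (hρ.2.mul_prod (P2_integrable_norm hμ)).mono' (by fun_prop) (ae_of_all _ fun p => ?_)
    exact norm_inner_le_norm p.1 p.2
  refine ne_bot_of_le_ne_bot (EReal.coe_ne_bot (∫ p, ⟪p.1, p.2⟫ ∂(ρ.prod μ))) ?_
  rw [← sInt_of_integrable hi]
  exact le_iSup₂_of_le _ prod_mem_couplings le_rfl

theorem finite_of_Ffun_ne_top {α : ℝ} (hα : 0 < α) {μ ρ : Measure (Ed d)} (hμ : μ ∈ P2 d)
    (hρ : ρ ∈ P1 d) (h : Ffun α μ ρ ≠ ⊤) : ρ ∈ P2 d ∧ FiniteEnt ρ := by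
  have hE := Ent_ne_bot hρ
  have hT := maxCorr_ne_bot hρ hμ
  have hET : Ent ρ + maxCorr ρ μ ≠ ⊥ := by
    rw [Ne, EReal.add_eq_bot_iff]; tauto
  have hM : M2e ρ ≠ ⊤ := by
    intro hM
    apply h
    rw [Ffun, hM, EReal.coe_ennreal_top, EReal.coe_mul_top_of_pos (by positivity),
      EReal.add_top_of_ne_bot hET]
  have hP2 : ρ ∈ P2 d := by
    refine ⟨hρ.1, by fun_prop, ?_⟩
    rw [hasFiniteIntegral_iff_norm]
    simp only [norm_pow, norm_norm]
    exact hM.lt_top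
  refine ⟨hP2, finiteEnt_of_Ent_ne_top hρ fun hE' => h ?_⟩
  rw [Ffun, hE', maxCorr_eq_corr hP2 hμ, coe_M2e hP2, EReal.top_add_coe]
  exact EReal.top_add_coe _

/-- The uniform measure on the unit cube. -/
theorem exists_test_measure (d : ℕ) :
    ∃ σ : Measure (Ed d), σ ∈ P2 d ∧ FiniteEnt σ ∧ entR σ = 0 ∧ m2 σ ≤ d := by
  let S : Set (Ed d) := (WithLp.ofLp) ⁻¹' (Set.univ.pi fun _ => Set.Ioc (0 : ℝ) 1)
  have hp : MeasurePreserving (WithLp.ofLp : Ed d → Fin d → ℝ) volume volume :=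
    PiLp.volume_preserving_ofLp (Fin d)
  have hSm : MeasurableSet S := hp.measurable (MeasurableSet.univ_pi fun _ => measurableSet_Ioc)
  have hS : volume S = 1 := by
    rw [hp.measure_preimage (MeasurableSet.univ_pi fun _ => measurableSet_Ioc).nullMeasurableSet,
      Real.volume_pi_Ioc]
    simp
  have hprob : IsProbabilityMeasure ((volume : Measure (Ed d)).restrict S) :=
    ⟨by rw [Measure.restrict_apply_univ, hS]⟩
  have hent : entFn ((volume : Measure (Ed d)).restrict S) =ᵐ[volume] fun _ => 0 := by
    filter_upwards [Measure.rnDeriv_restrict_self volume hSm] with x hx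
    rw [entFn, hx]
    by_cases hxS : x ∈ S <;> simp [hxS]
  have hb : ∀ᵐ x ∂((volume : Measure (Ed d)).restrict S), ‖x‖ ^ 2 ≤ d := by
    filter_upwards [ae_restrict_mem hSm] with x hx
    rw [EuclideanSpace.norm_sq_eq]
    have : ∀ i ∈ Finset.univ, ‖x i‖ ^ 2 ≤ (1 : ℝ) := by
      intro i _
      have h := hx i (Set.mem_univ i)
      rw [Real.norm_eq_abs, sq_abs]
      have h1 : 0 < x i := h.1
      have h2 : x i ≤ 1 := h.2
      nlinarith
    simpa using Finset.sum_le_card_nsmul _ _ _ this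
  have hi : Integrable (fun x : Ed d => ‖x‖ ^ 2) ((volume : Measure (Ed d)).restrict S) := by
    refine Integrable.mono' (integrable_const (d : ℝ)) (by fun_prop) ?_
    filter_upwards [hb] with x hx
    rwa [Real.norm_of_nonneg (by positivity)]
  refine ⟨volume.restrict S, ⟨hprob, hi⟩, ⟨Measure.restrict_le_self.absolutelyContinuous, ?_⟩,
    ?_, ?_⟩
  · exact (integrable_zero _ _ _).congr hent.symm
  · rw [entR, integral_congr_ae hent, integral_zero]
  · have := integral_mono_ae hi (integrable_const (d : ℝ)) hb
    simpa [m2] using this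

/-- Basic properties of minimizers. -/
theorem IsMinOfF.finite {α : ℝ} (hα : 0 < α) {μ ρ : Measure (Ed d)} (hμ : μ ∈ P2 d)
    (h : IsMinOfF α μ ρ) : ρ ∈ P2 d ∧ FiniteEnt ρ := by
  obtain ⟨σ, h1, h2, -, -⟩ := exists_test_measure d
  refine finite_of_Ffun_ne_top hα hμ h.1 (ne_top_of_le_ne_top ?_ (h.2 σ (P2_subset_P1 h1)))
  rw [Ffun_eq_FR hμ h1 h2]
  exact EReal.coe_ne_top _

theorem IsMinOfF.FR_le {α : ℝ} (hα : 0 < α) {μ ρ : Measure (Ed d)} (hμ : μ ∈ P2 d)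
    (h : IsMinOfF α μ ρ) {σ : Measure (Ed d)} (h1 : σ ∈ P2 d) (h2 : FiniteEnt σ) :
    FR α μ ρ ≤ FR α μ σ := by
  obtain ⟨h3, h4⟩ := h.finite hα hμ
  have := h.2 σ (P2_subset_P1 h1)
  rwa [Ffun_eq_FR hμ h1 h2, Ffun_eq_FR hμ h3 h4, EReal.coe_le_coe_iff] at this

/-- Uniform bound on the second moment of minimizers. -/
theorem exists_m2_bound (d : ℕ) {α : ℝ} (hα : 0 < α) (M : ℝ) :
    ∃ R : ℝ, 0 < R ∧ ∀ μ ρ : Measure (Ed d), μ ∈ P2 d → m2 μ ≤ M → IsMinOfF α μ ρ → m2 ρ ≤ R := by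
  set K := ∫ x : Ed d, (1 + ‖x‖) ^ (-(d + 1 : ℝ)) with hK
  set C := (d + M) / 2 + α / 2 * d + K + 2 * (d + 1) ^ 2 / α + 2 * M / α with hC
  refine ⟨4 / α * |C| + 1, by positivity, fun μ ρ hμ hM h => ?_⟩
  obtain ⟨σ, h1, h2, h3, h4⟩ := exists_test_measure d
  obtain ⟨h5, h6⟩ := h.finite hα hμ
  have h7 := h.FR_le hα hμ h1 h2
  have := h5.1
  have cσ : corr σ μ ≤ (d + M) / 2 := by
    refine (corr_le_sqrt h1 hμ).trans ?_
    have e1 := Real.sq_sqrt (m2_nonneg σ)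
    have e2 := Real.sq_sqrt (m2_nonneg μ)
    nlinarith [sq_nonneg (√(m2 σ) - √(m2 μ))]
  have am : ∀ a b : ℝ, a * b ≤ α / 8 * a ^ 2 + 2 * b ^ 2 / α := by
    intro a b
    have : α / 8 * a ^ 2 + 2 * b ^ 2 / α - a * b = (α * a - 4 * b) ^ 2 / (8 * α) := by
      field_simp; ring
    have h' : 0 ≤ (α * a - 4 * b) ^ 2 / (8 * α) := by positivity
    linarith
  have cρ : -(α / 8 * m2 ρ + 2 * M / α) ≤ corr ρ μ := by
    refine le_trans ?_ (neg_le_corr h5 hμ)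
    have h' := am (√(m2 ρ)) (√(m2 μ))
    rw [Real.sq_sqrt (m2_nonneg ρ), Real.sq_sqrt (m2_nonneg μ)] at h'
    have : 2 * m2 μ / α ≤ 2 * M / α := by gcongr
    linarith
  have eρ : -entR ρ ≤ α / 8 * m2 ρ + 2 * (d + 1) ^ 2 / α + K := by
    refine (neg_entR_le (P2_subset_P1 h5) h6).trans ?_
    have h8 : ∫ x, ‖x‖ * ((d : ℝ) + 1) ∂ρ ≤ ∫ x, (α / 8 * ‖x‖ ^ 2 + 2 * (d + 1) ^ 2 / α) ∂ρ :=
      integral_mono ((P2_integrable_norm h5).mul_const _)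
        ((h5.2.const_mul _).add (integrable_const _)) fun x => am _ _
    rw [integral_mul_const, integral_add (h5.2.const_mul _) (integrable_const _),
      integral_const_mul] at h8
    simp only [integral_const, probReal_univ, one_smul] at h8
    rw [m2]
    linarith
  have h9 : α / 4 * m2 ρ ≤ C := by
    have : α / 2 * m2 σ ≤ α / 2 * d := by gcongr
    rw [FR, FR, h3] at h7
    linarith
  have h10 : m2 ρ = 4 / α * (α / 4 * m2 ρ) := by field_simp
  rw [h10]
  have : 4 / α * (α / 4 * m2 ρ) ≤ 4 / α * |C| := by
    gcongr
    exact h9.trans (le_abs_self C)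
  linarith

end Entropy

section Boxes

variable {d : ℕ}

/-- The half-open box with lower corner `lo` and upper corner `hi`. -/
def box (lo hi : Fin d → ℝ) : Set (Ed d) := {x | ∀ k, lo k < x k ∧ x k ≤ hi k}

theorem box_eq_preimage (lo hi : Fin d → ℝ) :
    box lo hi = WithLp.ofLp ⁻¹' (Set.univ.pi fun k => Set.Ioc (lo k) (hi k)) := by
  ext x
  simp [box]

theorem measurableSet_box (lo hi : Fin d → ℝ) : MeasurableSet (box lo hi) := by
  rw [box_eq_preimage]
  exact (PiLp.volume_preserving_ofLp (Fin d)).measurable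
    (MeasurableSet.univ_pi fun _ => measurableSet_Ioc)

theorem volume_box (lo hi : Fin d → ℝ) :
    volume (box lo hi) = ∏ k, ENNReal.ofReal (hi k - lo k) := by
  rw [box_eq_preimage, (PiLp.volume_preserving_ofLp (Fin d)).measure_preimage
    (MeasurableSet.univ_pi fun _ => measurableSet_Ioc).nullMeasurableSet, Real.volume_pi_Ioc]

theorem volume_hyperplane (k : Fin d) (t : ℝ) : volume {x : Ed d | x k = t} = 0 := by
  have h : {x : Ed d | x k = t} = WithLp.ofLp ⁻¹' {y : Fin d → ℝ | y k = t} := rfl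
  have hm : MeasurableSet {y : Fin d → ℝ | y k = t} :=
    measurableSet_eq_fun (measurable_pi_apply k) measurable_const
  rw [h, (PiLp.volume_preserving_ofLp (Fin d)).measure_preimage hm.nullMeasurableSet, volume_pi]
  exact Measure.pi_hyperplane (fun _ : Fin d => (volume : Measure ℝ)) k t

theorem exists_equal_split {ρ : Measure (Ed d)} [IsFiniteMeasure ρ] (hac : ρ ≪ volume)
    {N : ℕ} (hN : 0 < N) (k : Fin d) {lo hi : Fin d → ℝ} (hk : lo k ≤ hi k)
    (hpos : 0 < ρ.real (box lo hi)) :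
    ∃ a : ℕ → ℝ, Monotone a ∧ (∀ c, lo k ≤ a c ∧ a c ≤ hi k) ∧
      ∀ c < N, ρ.real (box (Function.update lo k (a c)) (Function.update hi k (a (c + 1)))) =
        ρ.real (box lo hi) / N := by
  have hev : Measurable fun x : Ed d => x k := by fun_prop
  let m : Measure ℝ := (ρ.restrict (box lo hi)).map fun x => x k
  have hm : IsFiniteMeasure m := Measure.isFiniteMeasure_map _ _
  have hna : NullSingletonClass m := by
    refine ⟨fun t => ?_⟩
    rw [Measure.map_apply hev (measurableSet_singleton t)]
    exact (Measure.restrict_le_self.absolutelyContinuous.trans hac) (volume_hyperplane k t)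
  have hii : ∀ a b : ℝ, IntervalIntegrable (fun _ => (1 : ℝ)) m a b := fun a b =>
    ⟨integrable_const _, integrable_const _⟩
  let G : ℝ → ℝ := fun b => ∫ _ in lo k..b, (1 : ℝ) ∂m
  have hG : Continuous G := intervalIntegral.continuous_primitive hii _
  have hsub : ∀ s t, s ≤ t → m.real (Set.Ioc s t) = G t - G s := by
    intro s t hst
    have := intervalIntegral.integral_interval_sub_left (hii (lo k) t) (hii (lo k) s)
    rw [this, intervalIntegral.integral_of_le hst]
    simp
  have hGmono : Monotone G := by
    intro s t hst
    have := hsub s t hst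
    have h0 : 0 ≤ m.real (Set.Ioc s t) := measureReal_nonneg
    linarith
  have hm_real : ∀ s t, m.real (Set.Ioc s t) = ρ.real ({x | s < x k ∧ x k ≤ t} ∩ box lo hi) := by
    intro s t
    rw [Measure.real, Measure.map_apply hev measurableSet_Ioc,
      Measure.restrict_apply (hev measurableSet_Ioc)]
    rfl
  have hG0 : G (lo k) = 0 := intervalIntegral.integral_same
  have hG1 : G (hi k) = ρ.real (box lo hi) := by
    have h := hsub _ _ hk
    rw [hG0, sub_zero] at h
    rw [← h, hm_real]
    congr 1
    exact Set.inter_eq_right.2 fun x hx => hx k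
  set T := ρ.real (box lo hi)
  have hN' : (0 : ℝ) < N := by exact_mod_cast hN
  have hex : ∀ c : ℕ, ∃ t ∈ Set.Icc (lo k) (hi k), G t = (min c N : ℕ) * T / N := by
    intro c
    refine intermediate_value_Icc hk hG.continuousOn ?_
    rw [hG0, hG1]
    refine ⟨by positivity, ?_⟩
    rw [div_le_iff₀ hN', mul_comm T]
    gcongr
    exact min_le_right _ _
  choose b hb1 hb2 using hex
  let a : ℕ → ℝ := fun c => b (min c N)
  have ha2 : ∀ c, G (a c) = (min c N : ℕ) * T / N := by
    intro c
    simp only [a, hb2]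
    simp
  have hmono : Monotone a := by
    intro c c' hcc
    rcases (min_le_min_right N hcc).eq_or_lt with h | h
    · simp only [a, h, le_refl]
    · by_contra! hlt
      have h1 := hGmono hlt.le
      rw [ha2, ha2, div_le_div_iff_of_pos_right hN', mul_le_mul_iff_left₀ hpos, Nat.cast_le] at h1
      omega
  refine ⟨a, hmono, fun c => hb1 _, fun c hc => ?_⟩
  have hbox : box (Function.update lo k (a c)) (Function.update hi k (a (c + 1))) =
      {x | a c < x k ∧ x k ≤ a (c + 1)} ∩ box lo hi := by
    ext x
    constructor
    · intro hx
      have hxk := hx k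
      simp only [Function.update_self] at hxk
      refine ⟨hxk, fun l => ?_⟩
      by_cases hl : l = k
      · subst hl
        exact ⟨(hb1 _).1.trans_lt hxk.1, hxk.2.trans (hb1 _).2⟩
      · have := hx l
        rwa [Function.update_of_ne hl, Function.update_of_ne hl] at this
    · rintro ⟨hxk, hx⟩ l
      by_cases hl : l = k
      · subst hl
        simpa using hxk
      · rw [Function.update_of_ne hl, Function.update_of_ne hl]
        exact hx l
  rw [hbox, ← hm_real, hsub _ _ (hmono (Nat.le_succ c)), ha2, ha2, min_eq_left hc.le,
    min_eq_left (Nat.succ_le_of_lt hc)]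
  push_cast
  ring

/-- A family of boxes indexed by multi-indices which is ordered like a triangular partition. -/
def OrderedBoxes {N : ℕ} (lo hi : (Fin d → Fin N) → Fin d → ℝ) : Prop :=
  ∀ i j k, (∀ l < k, i l = j l) → i k < j k → hi i k ≤ lo j k

theorem OrderedBoxes.disjoint {N : ℕ} {lo hi : (Fin d → Fin N) → Fin d → ℝ}
    (h : OrderedBoxes lo hi) {i j : Fin d → Fin N} (hij : i ≠ j) :
    Disjoint (box (lo i) (hi i)) (box (lo j) (hi j)) := by
  have key : ∀ i j : Fin d → Fin N, toLex i < toLex j →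
      Disjoint (box (lo i) (hi i)) (box (lo j) (hi j)) := by
    rintro i j ⟨k, hk1, hk2⟩
    refine Set.disjoint_left.2 fun x hx hx' => ?_
    exact absurd ((hx k).2.trans (h i j k hk1 hk2)) (not_le.2 (hx' k).1)
  rcases lt_or_gt_of_ne (a := toLex i) (b := toLex j) (by simpa using hij) with hlt | hlt
  · exact key i j hlt
  · exact (key j i hlt).symm

theorem sum_sub_le_of_ordered {N : ℕ} {lo hi : Fin N → ℝ} {A U : ℝ} (hA : ∀ c, A ≤ lo c)
    (hU : ∀ c, hi c ≤ U) (hAU : A ≤ U) (h : ∀ c c', c < c' → hi c ≤ lo c') :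
    ∑ c, (hi c - lo c) ≤ U - A := by
  induction N generalizing U with
  | zero => simpa using hAU
  | succ n ih =>
    rw [Fin.sum_univ_castSucc]
    have h1 := ih (lo := fun c => lo c.castSucc) (hi := fun c => hi c.castSucc)
      (U := lo (Fin.last n)) (fun c => hA _) (fun c => h _ _ (Fin.castSucc_lt_last c)) (hA _)
      (fun c c' hc => h _ _ (by simpa using hc))
    have h2 := hU (Fin.last n)
    linarith

theorem OrderedBoxes.sum_side_le {N : ℕ} {lo hi : (Fin d → Fin N) → Fin d → ℝ}
    (h : OrderedBoxes lo hi) {L : ℝ} (hL : 0 ≤ L) (hlo : ∀ i k, -L ≤ lo i k)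
    (hhi : ∀ i k, hi i k ≤ L) (k : Fin d) :
    ∑ i, (hi i k - lo i k) ≤ N ^ (d - 1) * (2 * L) := by
  rw [← (Equiv.funSplitAt k (Fin N)).symm.sum_comp, Fintype.sum_prod_type_right]
  have hcard : (Fintype.card ({j // j ≠ k} → Fin N) : ℝ) = N ^ (d - 1) := by
    simp [Fintype.card_subtype_compl]
  rw [← hcard, ← nsmul_eq_mul]
  refine Finset.sum_le_card_nsmul _ _ _ fun g _ => ?_
  refine (sum_sub_le_of_ordered (A := -L) (U := L) (fun c => hlo _ _) (fun c => hhi _ _)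
    (by linarith) fun c c' hc => h _ _ k (fun l hl => ?_) ?_).trans_eq (by ring)
  · simp [Equiv.funSplitAt_symm_apply, hl.ne]
  · simpa [Equiv.funSplitAt_symm_apply] using hc

theorem exists_equal_boxes {ρ : Measure (Ed d)} [IsProbabilityMeasure ρ] (hac : ρ ≪ volume)
    {L : ℝ} (hL : 0 ≤ L) (hsupp : ρ.real (box (fun _ => -L) (fun _ => L)) = 1) {N : ℕ}
    (hN : 0 < N) :
    ∃ lo hi : (Fin d → Fin N) → Fin d → ℝ,
      (∀ i k, -L ≤ lo i k ∧ lo i k ≤ hi i k ∧ hi i k ≤ L) ∧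
      (∀ i, ρ.real (box (lo i) (hi i)) = (1 / N) ^ d) ∧ OrderedBoxes lo hi := by
  have hN' : (0 : ℝ) < N := by exact_mod_cast hN
  have key : ∀ n ≤ d, ∃ lo hi : (Fin d → Fin N) → Fin d → ℝ,
      (∀ i k, -L ≤ lo i k ∧ lo i k ≤ hi i k ∧ hi i k ≤ L) ∧
      (∀ i, ρ.real (box (lo i) (hi i)) = (1 / N) ^ n) ∧
      (∀ i j, (∀ l : Fin d, (l : ℕ) < n → i l = j l) → lo i = lo j ∧ hi i = hi j) ∧
      (∀ i j (k : Fin d), (k : ℕ) < n → (∀ l < k, i l = j l) → i k < j k → hi i k ≤ lo j k) := by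
    intro n
    induction n with
    | zero =>
      intro _
      refine ⟨fun _ _ => -L, fun _ _ => L, fun _ _ => ⟨le_rfl, by linarith, le_rfl⟩, ?_, ?_, ?_⟩
      · intro i; simpa using hsupp
      · intro i j _; exact ⟨rfl, rfl⟩
      · intro i j k hk; omega
    | succ n ih =>
      intro hn
      obtain ⟨lo, hi, h1, h2, h3, h4⟩ := ih (by omega)
      let k₀ : Fin d := ⟨n, by omega⟩
      have hsplit : ∀ p : (Fin d → ℝ) × (Fin d → ℝ), ∃ a : ℕ → ℝ, p.1 k₀ ≤ p.2 k₀ →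
          0 < ρ.real (box p.1 p.2) → Monotone a ∧ (∀ c, p.1 k₀ ≤ a c ∧ a c ≤ p.2 k₀) ∧
          ∀ c < N, ρ.real (box (Function.update p.1 k₀ (a c))
            (Function.update p.2 k₀ (a (c + 1)))) = ρ.real (box p.1 p.2) / N := by
        intro p
        by_cases hp : p.1 k₀ ≤ p.2 k₀ ∧ 0 < ρ.real (box p.1 p.2)
        · obtain ⟨a, ha⟩ := exists_equal_split hac hN k₀ hp.1 hp.2
          exact ⟨a, fun _ _ => ha⟩
        · exact ⟨0, fun h h' => absurd ⟨h, h'⟩ hp⟩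
      choose a ha using hsplit
      have ha' : ∀ i, Monotone (a (lo i, hi i)) ∧
          (∀ c, lo i k₀ ≤ a (lo i, hi i) c ∧ a (lo i, hi i) c ≤ hi i k₀) ∧
          ∀ c < N, ρ.real (box (Function.update (lo i) k₀ (a (lo i, hi i) c))
            (Function.update (hi i) k₀ (a (lo i, hi i) (c + 1)))) =
              ρ.real (box (lo i) (hi i)) / N :=
        fun i => ha (lo i, hi i) (h1 i k₀).2.1 (by simp only [h2]; positivity)
      refine ⟨fun i => Function.update (lo i) k₀ (a (lo i, hi i) (i k₀)),
        fun i => Function.update (hi i) k₀ (a (lo i, hi i) (i k₀ + 1)), ?_, ?_, ?_, ?_⟩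
      · intro i k
        by_cases hk : k = k₀
        · subst hk
          simp only [Function.update_self]
          obtain ⟨m1, m2, -⟩ := ha' i
          exact ⟨(h1 i _).1.trans (m2 _).1, m1 (Nat.le_succ _), (m2 _).2.trans (h1 i _).2.2⟩
        · simp only [Function.update_of_ne hk]
          exact h1 i k
      · intro i
        rw [(ha' i).2.2 _ (i k₀).2, h2, pow_succ]
        ring
      · intro i j hij
        obtain ⟨e1, e2⟩ := h3 i j fun l hl => hij l (by omega)
        have e3 : i k₀ = j k₀ := hij k₀ (Nat.lt_succ_self n)
        simp only [e1, e2, e3, and_self]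
      · intro i j k hk hij hlt
        by_cases hk' : k = k₀
        · subst hk'
          obtain ⟨e1, e2⟩ := h3 i j fun l hl => hij l hl
          simp only [Function.update_self, e1, e2]
          exact (ha' j).1 (Nat.succ_le_of_lt hlt)
        · simp only [Function.update_of_ne hk']
          have : (k : ℕ) ≠ n := fun h => hk' (Fin.ext h)
          exact h4 i j k (by omega) hij hlt
  obtain ⟨lo, hi, h1, h2, -, h4⟩ := key d le_rfl
  exact ⟨lo, hi, h1, h2, fun i j k => h4 i j k k.2⟩

end Boxes

section BlockCoupling

variable {d : ℕ}

theorem add_sub_le_mul_log {s c : ℝ} (hs : 0 ≤ s) (hc : 0 < c) :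
    s * Real.log c + s - c ≤ s * Real.log s := by
  rcases hs.eq_or_lt with rfl | hs
  · simp [hc.le]
  have h1 := Real.log_le_sub_one_of_pos (div_pos hc hs)
  rw [Real.log_div hc.ne' hs.ne'] at h1
  have h2 := mul_le_mul_of_nonneg_left h1 hs.le
  have h3 : s * (c / s - 1) = c - s := by field_simp
  linarith

theorem mul_log_div_le_setIntegral {ρ : Measure (Ed d)} [IsFiniteMeasure ρ] (h : FiniteEnt ρ)
    {S : Set (Ed d)} (hS : volume S ≠ ⊤) (hpos : 0 < ρ.real S) :
    ρ.real S * Real.log (ρ.real S / volume.real S) ≤ ∫ x in S, entFn ρ x := by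
  have hV : 0 < volume.real S := by
    refine ENNReal.toReal_pos (fun h0 => ?_) hS
    simp [Measure.real, h.1 h0] at hpos
  set c := ρ.real S / volume.real S
  have hc : 0 < c := div_pos hpos hV
  have hi : IntegrableOn (fun x => (ρ.rnDeriv volume x).toReal) S volume :=
    Measure.integrable_toReal_rnDeriv.integrableOn
  have hic : IntegrableOn (fun _ : Ed d => c) S volume := integrableOn_const hS
  have h1 : ∫ x in S, ((ρ.rnDeriv volume x).toReal * Real.log c + (ρ.rnDeriv volume x).toReal - c)
      ≤ ∫ x in S, entFn ρ x :=
    integral_mono (((hi.mul_const _).add hi).sub hic) h.2.integrableOn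
      fun x => add_sub_le_mul_log toReal_nonneg hc
  have his : IntegrableOn (fun x => (ρ.rnDeriv volume x).toReal * Real.log c +
      (ρ.rnDeriv volume x).toReal) S volume := (hi.mul_const _).add hi
  rw [integral_sub his hic, integral_add (hi.mul_const _) hi,
    integral_mul_const, Measure.setIntegral_toReal_rnDeriv h.1] at h1
  have h2 : ∫ _ in S, c = ρ.real S := by
    rw [setIntegral_const, smul_eq_mul]
    exact mul_div_cancel₀ _ hV.ne'
  linarith

theorem setIntegral_entFn_of_ae_mem {ρ : Measure (Ed d)} [IsFiniteMeasure ρ] (h : ρ ≪ volume)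
    {U : Set (Ed d)} (hU : MeasurableSet U) (hρ : ∀ᵐ x ∂ρ, x ∈ U) :
    ∫ x in U, entFn ρ x = entR ρ := by
  refine setIntegral_eq_integral_of_ae_compl_eq_zero ?_
  have h1 : ∫⁻ x in Uᶜ, ρ.rnDeriv volume x = 0 := by
    rw [Measure.setLIntegral_rnDeriv h]; exact hρ
  rw [lintegral_eq_zero_iff (Measure.measurable_rnDeriv _ _), Filter.EventuallyEq,
    ae_restrict_iff' hU.compl] at h1
  filter_upwards [h1] with x hx hxU
  simp [entFn, hx hxU]

theorem ae_mem_iUnion_of_sum_eq_one {ι : Type*} [Fintype ι] {ρ : Measure (Ed d)}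
    [IsProbabilityMeasure ρ] {R : ι → Set (Ed d)} (hR : ∀ i, MeasurableSet (R i))
    (hd : Pairwise (Function.onFun Disjoint R)) (h1 : ∑ i, ρ.real (R i) = 1) :
    ∀ᵐ x ∂ρ, x ∈ ⋃ i, R i := by
  refine (prob_compl_eq_zero_iff (MeasurableSet.iUnion hR)).2 ?_
  rw [measure_iUnion hd hR, tsum_fintype, ← ENNReal.ofReal_one, ← h1,
    ENNReal.ofReal_sum_of_nonneg fun i _ => measureReal_nonneg]
  exact Finset.sum_congr rfl fun i _ => (ofReal_measureReal).symm

theorem sum_restrict_eq_self {ι : Type*} [Fintype ι] {ρ : Measure (Ed d)}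
    [IsProbabilityMeasure ρ] {R : ι → Set (Ed d)} (hR : ∀ i, MeasurableSet (R i))
    (hd : Pairwise (Function.onFun Disjoint R)) (h1 : ∑ i, ρ.real (R i) = 1) :
    Measure.sum (fun i => ρ.restrict (R i)) = ρ := by
  rw [← Measure.restrict_iUnion hd hR,
    Measure.restrict_eq_self_of_ae_mem (ae_mem_iUnion_of_sum_eq_one hR hd h1)]

theorem sum_mul_log_div_le_entR {ι : Type*} [Fintype ι] {ρ : Measure (Ed d)}
    [IsProbabilityMeasure ρ] (h : FiniteEnt ρ) {R : ι → Set (Ed d)} (hR : ∀ i, MeasurableSet (R i))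
    (hd : Pairwise (Function.onFun Disjoint R)) (h1 : ∑ i, ρ.real (R i) = 1)
    (hfin : ∀ i, volume (R i) ≠ ⊤) (hpos : ∀ i, 0 < ρ.real (R i)) :
    ∑ i, ρ.real (R i) * Real.log (ρ.real (R i) / volume.real (R i)) ≤ entR ρ := by
  rw [← setIntegral_entFn_of_ae_mem h.1 (MeasurableSet.iUnion hR)
    (ae_mem_iUnion_of_sum_eq_one hR hd h1),
    integral_iUnion_fintype hR hd fun i => h.2.integrableOn]
  exact Finset.sum_le_sum fun i _ => mul_log_div_le_setIntegral h (hfin i) (hpos i)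

/-- The mixture of uniform measures on the sets `Z i` giving mass `q` to each of them. -/
def unifMix {ι : Type*} (q : ℝ) (Z : ι → Set (Ed d)) : Measure (Ed d) :=
  Measure.sum fun i => ENNReal.ofReal (q / volume.real (Z i)) • volume.restrict (Z i)

theorem unifMix_finiteEnt {ι : Type*} [Fintype ι] {q : ℝ} (hq : 0 < q) {Z : ι → Set (Ed d)}
    (hZ : ∀ i, MeasurableSet (Z i)) (hd : Pairwise (Function.onFun Disjoint Z))
    (hfin : ∀ i, volume (Z i) ≠ ⊤) (hpos : ∀ i, 0 < volume.real (Z i)) :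
    FiniteEnt (unifMix q Z) ∧
      entR (unifMix q Z) = ∑ i, q * Real.log (q / volume.real (Z i)) := by
  let h : Ed d → ℝ := fun x => ∑ i, (Z i).indicator (fun _ => q / volume.real (Z i)) x
  have hm : Measurable h := Finset.measurable_sum _ fun i _ => measurable_const.indicator (hZ i)
  have h0i : ∀ i x, 0 ≤ (Z i).indicator (fun _ => q / volume.real (Z i)) x := fun i x =>
    Set.indicator_nonneg (fun _ _ => (div_pos hq (hpos i)).le) x
  have h0 : ∀ x, 0 ≤ h x := fun x => Finset.sum_nonneg fun i _ => h0i i x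
  have hσ : unifMix q Z = volume.withDensity fun x => ENNReal.ofReal (h x) := by
    have : (fun x => ENNReal.ofReal (h x)) =
        ∑' i, (Z i).indicator fun _ => ENNReal.ofReal (q / volume.real (Z i)) := by
      ext x
      rw [tsum_fintype, Finset.sum_apply, ENNReal.ofReal_sum_of_nonneg fun i _ => h0i i x]
      refine Finset.sum_congr rfl fun i _ => ?_
      by_cases hx : x ∈ Z i <;> simp [hx]
    rw [this, withDensity_tsum fun i => measurable_const.indicator (hZ i), unifMix]
    congr 1
    ext1 i
    rw [withDensity_indicator (hZ i), withDensity_const]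
  have hlog : ∀ x, h x * Real.log (h x) = ∑ i, (Z i).indicator
      (fun _ => q / volume.real (Z i) * Real.log (q / volume.real (Z i))) x := by
    intro x
    by_cases hx : ∃ i, x ∈ Z i
    · obtain ⟨i, hi⟩ := hx
      have hj : ∀ j, j ≠ i → x ∉ Z j := fun j hj hxj => Set.disjoint_left.1 (hd hj) hxj hi
      have : h x = q / volume.real (Z i) := by
        simp only [h]
        rw [Finset.sum_eq_single i (fun j _ hji => by simp [hj j hji]) (by simp)]
        simp [hi]
      rw [this, Finset.sum_eq_single i (fun j _ hji => by simp [hj j hji]) (by simp)]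
      simp [hi]
    · push Not at hx
      simp [h, hx]
  have hae : entFn (unifMix q Z) =ᵐ[volume] fun x => ∑ i, (Z i).indicator
      (fun _ => q / volume.real (Z i) * Real.log (q / volume.real (Z i))) x := by
    rw [hσ]
    exact (entFn_withDensity hm h0).trans (ae_of_all _ hlog)
  have hint : ∀ i, Integrable ((Z i).indicator
      (fun _ => q / volume.real (Z i) * Real.log (q / volume.real (Z i)))) volume := fun i =>
    (integrable_indicator_iff (hZ i)).2 (integrableOn_const (hfin i))
  refine ⟨⟨?_, (integrable_finsetSum _ fun i _ => hint i).congr hae.symm⟩, ?_⟩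
  · rw [hσ]; exact withDensity_absolutelyContinuous _ _
  · rw [entR, integral_congr_ae hae, integral_finsetSum _ fun i _ => hint i]
    refine Finset.sum_congr rfl fun i _ => ?_
    rw [integral_indicator (hZ i), setIntegral_const, smul_eq_mul]
    have := (hpos i).ne'
    field_simp

/-- The coupling of `ρ₀`, `ρ₁` and `unifMix q Z` that matches `R i`, `S i` and `Z i`. -/
def blockCoupling {ι : Type*} (q : ℝ) (ρ₀ ρ₁ : Measure (Ed d)) (R S Z : ι → Set (Ed d)) :
    Measure ((Ed d × Ed d) × Ed d) :=
  Measure.sum fun i => ENNReal.ofReal (1 / (q * volume.real (Z i))) •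
    ((ρ₀.restrict (R i)).prod (ρ₁.restrict (S i))).prod (volume.restrict (Z i))

theorem ofReal_mul_measure_eq {ι : Type*} {q : ℝ} (hq : 0 < q) {ρ : Measure (Ed d)}
    [IsFiniteMeasure ρ] {S Z : ι → Set (Ed d)} (hS : ∀ i, ρ.real (S i) = q)
    (hfin : ∀ i, volume (Z i) ≠ ⊤) (hpos : ∀ i, 0 < volume.real (Z i)) (i : ι) :
    ENNReal.ofReal (1 / (q * volume.real (Z i))) * volume (Z i) * ρ (S i) = 1 ∧
    ENNReal.ofReal (1 / (q * volume.real (Z i))) * ρ (S i) * ρ (S i) =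
      ENNReal.ofReal (q / volume.real (Z i)) := by
  have h1 : volume (Z i) = ENNReal.ofReal (volume.real (Z i)) := (ofReal_measureReal (hfin i)).symm
  have h2 : ρ (S i) = ENNReal.ofReal q := by rw [← hS i, ofReal_measureReal]
  have := (hpos i).ne'
  have h3 : 0 ≤ 1 / (q * volume.real (Z i)) := by have := (hpos i); positivity
  constructor
  · rw [h2]
    conv_lhs => rw [h1]
    rw [← ENNReal.ofReal_mul h3, ← ENNReal.ofReal_mul' hq.le, ← ENNReal.ofReal_one]
    congr 1
    field_simp
  · rw [h2, ← ENNReal.ofReal_mul h3, ← ENNReal.ofReal_mul' hq.le]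
    congr 1
    field_simp

variable {ι : Type*} {q : ℝ} {ρ₀ ρ₁ : Measure (Ed d)} [IsProbabilityMeasure ρ₀]
  [IsProbabilityMeasure ρ₁] {R S Z : ι → Set (Ed d)}

theorem blockCoupling_map_fst [Fintype ι] (hq : 0 < q) (hS : ∀ i, ρ₁.real (S i) = q)
    (hR : ∀ i, MeasurableSet (R i)) (hd : Pairwise (Function.onFun Disjoint R))
    (h1 : ∑ i, ρ₀.real (R i) = 1)
    (hfin : ∀ i, volume (Z i) ≠ ⊤) (hpos : ∀ i, 0 < volume.real (Z i)) :
    (blockCoupling q ρ₀ ρ₁ R S Z).map (fun p => p.1.1) = ρ₀ := by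
  conv_rhs => rw [← sum_restrict_eq_self hR hd h1]
  rw [blockCoupling, Measure.map_sum (by fun_prop)]
  congr 1
  ext1 i
  have : (fun p : (Ed d × Ed d) × Ed d => p.1.1) = Prod.fst ∘ Prod.fst := rfl
  rw [Measure.map_smul, this, ← Measure.map_map measurable_fst measurable_fst,
    Measure.map_fst_prod, Measure.map_smul, Measure.map_fst_prod, smul_smul, smul_smul,
    Measure.restrict_apply_univ, Measure.restrict_apply_univ,
    (ofReal_mul_measure_eq hq hS hfin hpos i).1, one_smul]

theorem blockCoupling_map_snd [Fintype ι] (hq : 0 < q) (hR : ∀ i, ρ₀.real (R i) = q)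
    (hS : ∀ i, MeasurableSet (S i)) (hd : Pairwise (Function.onFun Disjoint S))
    (h1 : ∑ i, ρ₁.real (S i) = 1)
    (hfin : ∀ i, volume (Z i) ≠ ⊤) (hpos : ∀ i, 0 < volume.real (Z i)) :
    (blockCoupling q ρ₀ ρ₁ R S Z).map (fun p => p.1.2) = ρ₁ := by
  conv_rhs => rw [← sum_restrict_eq_self hS hd h1]
  rw [blockCoupling, Measure.map_sum (by fun_prop)]
  congr 1
  ext1 i
  have : (fun p : (Ed d × Ed d) × Ed d => p.1.2) = Prod.snd ∘ Prod.fst := rfl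
  rw [Measure.map_smul, this, ← Measure.map_map measurable_snd measurable_fst,
    Measure.map_fst_prod, Measure.map_smul, Measure.map_snd_prod, smul_smul, smul_smul,
    Measure.restrict_apply_univ, Measure.restrict_apply_univ,
    (ofReal_mul_measure_eq hq hR hfin hpos i).1, one_smul]

theorem blockCoupling_map_mix (hq : 0 < q) (hR : ∀ i, ρ₀.real (R i) = q)
    (hS : ∀ i, ρ₁.real (S i) = q)
    (hfin : ∀ i, volume (Z i) ≠ ⊤) (hpos : ∀ i, 0 < volume.real (Z i)) :
    (blockCoupling q ρ₀ ρ₁ R S Z).map (fun p => p.2) = unifMix q Z := by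
  rw [blockCoupling, Measure.map_sum (by fun_prop), unifMix]
  congr 1
  ext1 i
  have h : ρ₁ (S i) = ρ₀ (R i) := by
    rw [← ofReal_measureReal (μ := ρ₁), ← ofReal_measureReal (μ := ρ₀), hR, hS]
  rw [Measure.map_smul, Measure.map_snd_prod, smul_smul, ← Set.univ_prod_univ, Measure.prod_prod,
    Measure.restrict_apply_univ, Measure.restrict_apply_univ, h, ← mul_assoc,
    (ofReal_mul_measure_eq hq hR hfin hpos i).2]

theorem lintegral_blockCoupling_le [Fintype ι] (hq : 0 < q) (hR : ∀ i, ρ₀.real (R i) = q)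
    (hS : ∀ i, ρ₁.real (S i) = q) (hRm : ∀ i, MeasurableSet (R i))
    (hSm : ∀ i, MeasurableSet (S i)) (hZm : ∀ i, MeasurableSet (Z i))
    (hfin : ∀ i, volume (Z i) ≠ ⊤) (hpos : ∀ i, 0 < volume.real (Z i))
    {f : (Ed d × Ed d) × Ed d → ℝ} {D : ι → ℝ} (hD : ∀ i, 0 ≤ D i)
    (hf : ∀ i, ∀ x ∈ R i, ∀ y ∈ S i, ∀ z ∈ Z i, f ((x, y), z) ≤ D i) :
    ∫⁻ p, ENNReal.ofReal (f p) ∂(blockCoupling q ρ₀ ρ₁ R S Z) ≤ ENNReal.ofReal (∑ i, q * D i) := by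
  rw [blockCoupling, lintegral_sum_measure, tsum_fintype,
    ENNReal.ofReal_sum_of_nonneg fun i _ => mul_nonneg hq.le (hD i)]
  refine Finset.sum_le_sum fun i _ => ?_
  rw [lintegral_smul_measure, Measure.prod_restrict, Measure.prod_restrict]
  have h1 : ∫⁻ p in (R i ×ˢ S i) ×ˢ Z i, ENNReal.ofReal (f p) ∂((ρ₀.prod ρ₁).prod volume) ≤
      ∫⁻ _ in (R i ×ˢ S i) ×ˢ Z i, ENNReal.ofReal (D i) ∂((ρ₀.prod ρ₁).prod volume) :=
    setLIntegral_mono' (((hRm i).prod (hSm i)).prod (hZm i)) fun p hp =>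
      ENNReal.ofReal_le_ofReal (hf i p.1.1 hp.1.1 p.1.2 hp.1.2 p.2 hp.2)
  rw [setLIntegral_const, Measure.prod_prod, Measure.prod_prod] at h1
  have h2 : ENNReal.ofReal q = ρ₀ (R i) := by rw [← hR i, ofReal_measureReal]
  rw [ENNReal.ofReal_mul hq.le, h2]
  refine (mul_le_mul_right h1 _).trans_eq ?_
  have h3 := (ofReal_mul_measure_eq hq hS hfin hpos i).1
  calc _ = ENNReal.ofReal (1 / (q * volume.real (Z i))) * volume (Z i) * ρ₁ (S i) *
        (ρ₀ (R i) * ENNReal.ofReal (D i)) := by ring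
    _ = _ := by rw [h3, one_mul]

end BlockCoupling

section BoxMidpoint

variable {d : ℕ}

/-- There is a measure `σ`, and a joint distribution of `ρ₀`, `ρ₁` and `σ`, showing that `σ` is a
midpoint of `ρ₀` and `ρ₁` up to an error `ε` in the mean square sense, and such that the midpoint
convexity of the entropy holds up to `ε`. -/
def HasApproxMidpoint (ρ₀ ρ₁ : Measure (Ed d)) (ε : ℝ) : Prop :=
  ∃ (σ : Measure (Ed d)) (Θ : Measure ((Ed d × Ed d) × Ed d)), σ ∈ P2 d ∧ FiniteEnt σ ∧
    entR σ ≤ 1 / 2 * entR ρ₀ + 1 / 2 * entR ρ₁ + ε ∧ IsProbabilityMeasure Θ ∧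
    Θ.map (fun p => p.1.1) = ρ₀ ∧ Θ.map (fun p => p.1.2) = ρ₁ ∧ Θ.map (fun p => p.2) = σ ∧
    ∫ p, ‖p.2 - (1 / 2 : ℝ) • (p.1.1 + p.1.2)‖ ^ 2 ∂Θ ≤ ε

theorem volume_box_ne_top (lo hi : Fin d → ℝ) : volume (box lo hi) ≠ ⊤ := by
  rw [volume_box]
  exact (ENNReal.prod_lt_top fun k _ => ofReal_lt_top).ne

theorem volume_real_box {lo hi : Fin d → ℝ} (h : ∀ k, lo k ≤ hi k) :
    volume.real (box lo hi) = ∏ k, (hi k - lo k) := by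
  rw [Measure.real, volume_box, ENNReal.toReal_prod]
  exact Finset.prod_congr rfl fun k _ => ENNReal.toReal_ofReal (sub_nonneg.2 (h k))

theorem norm_le_of_mem_box {L : ℝ} {lo hi : Fin d → ℝ} (hlo : ∀ k, -L ≤ lo k) (hhi : ∀ k, hi k ≤ L)
    {x : Ed d} (hx : x ∈ box lo hi) : ‖x‖ ≤ Real.sqrt (d * L ^ 2) := by
  rw [EuclideanSpace.norm_eq]
  refine Real.sqrt_le_sqrt ?_
  calc ∑ k, ‖x k‖ ^ 2 ≤ ∑ _k : Fin d, L ^ 2 := by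
        refine Finset.sum_le_sum fun k _ => ?_
        rw [Real.norm_eq_abs, sq_abs]
        have h1 := hx k
        have h2 := hlo k
        have h3 := hhi k
        exact sq_le_sq' (by linarith) (by linarith)
    _ = d * L ^ 2 := by simp

theorem half_log_prod_add_half_log_prod_le {r s : Fin d → ℝ} (hr : ∀ k, 0 < r k)
    (hs : ∀ k, 0 < s k) :
    1 / 2 * Real.log (∏ k, r k) + 1 / 2 * Real.log (∏ k, s k) ≤
      Real.log (∏ k, (1 / 2 * r k + 1 / 2 * s k)) := by
  have ht : ∀ k, 0 < 1 / 2 * r k + 1 / 2 * s k := fun k => by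
    have := hr k; have := hs k; positivity
  rw [Real.log_prod fun k _ => (hr k).ne', Real.log_prod fun k _ => (hs k).ne',
    Real.log_prod fun k _ => (ht k).ne', Finset.mul_sum, Finset.mul_sum,
    ← Finset.sum_add_distrib]
  exact Finset.sum_le_sum fun k _ =>
    strictConcaveOn_log_Ioi.concaveOn.2 (hr k) (hs k) (by norm_num) (by norm_num) (by norm_num)

theorem norm_sub_midpoint_sq_le {a₀ b₀ a₁ b₁ : Fin d → ℝ} {x y z : Ed d} (hx : x ∈ box a₀ b₀)
    (hy : y ∈ box a₁ b₁)
    (hz : z ∈ box (fun k => 1 / 2 * a₀ k + 1 / 2 * a₁ k) (fun k => 1 / 2 * b₀ k + 1 / 2 * b₁ k)) :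
    ‖z - (1 / 2 : ℝ) • (x + y)‖ ^ 2 ≤
      ∑ k, ((1 / 2 * b₀ k + 1 / 2 * b₁ k) - (1 / 2 * a₀ k + 1 / 2 * a₁ k)) ^ 2 := by
  rw [EuclideanSpace.norm_sq_eq]
  refine Finset.sum_le_sum fun k _ => ?_
  have h1 := hx k
  have h2 := hy k
  have h3 := hz k
  rw [Real.norm_eq_abs, sq_abs]
  simp only [PiLp.sub_apply, PiLp.smul_apply, PiLp.add_apply, smul_eq_mul]
  exact sq_le_sq' (by linarith) (by linarith)

theorem unifMix_mem_P2 {ι : Type*} [Fintype ι] {q L : ℝ} {lo hi : ι → Fin d → ℝ}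
    (hlo : ∀ i k, -L ≤ lo i k) (hhi : ∀ i k, hi i k ≤ L)
    (hp : IsProbabilityMeasure (unifMix q fun i => box (lo i) (hi i))) :
    unifMix q (fun i => box (lo i) (hi i)) ∈ P2 d := by
  refine ⟨hp, Integrable.of_bound (by fun_prop) (d * L ^ 2) ?_⟩
  rw [unifMix, Measure.ae_sum_iff]
  intro i
  refine Measure.ae_smul_measure ?_ _
  filter_upwards [ae_restrict_mem (measurableSet_box _ _)] with x hx
  rw [Real.norm_eq_abs, abs_of_nonneg (by positivity)]
  refine (pow_le_pow_left₀ (norm_nonneg _) (norm_le_of_mem_box (hlo i) (hhi i) hx) 2).trans_eq ?_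
  exact Real.sq_sqrt (by positivity)

theorem hasApproxMidpoint_of_box {ρ₀ ρ₁ : Measure (Ed d)} [IsProbabilityMeasure ρ₀]
    [IsProbabilityMeasure ρ₁] (h₀ : FiniteEnt ρ₀) (h₁ : FiniteEnt ρ₁) {L : ℝ} (hL : 0 ≤ L)
    (hs₀ : ρ₀.real (box (fun _ => -L) (fun _ => L)) = 1)
    (hs₁ : ρ₁.real (box (fun _ => -L) (fun _ => L)) = 1) {N : ℕ} (hN : 0 < N) :
    HasApproxMidpoint ρ₀ ρ₁ (d * (2 * L) ^ 2 / N) := by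
  have hN' : (0 : ℝ) < N := by exact_mod_cast hN
  obtain ⟨a₀, b₀, hab₀, hq₀, ho₀⟩ := exists_equal_boxes h₀.1 hL hs₀ hN
  obtain ⟨a₁, b₁, hab₁, hq₁, ho₁⟩ := exists_equal_boxes h₁.1 hL hs₁ hN
  set q : ℝ := (1 / N) ^ d with hq_def
  have hq : 0 < q := by positivity
  let a : (Fin d → Fin N) → Fin d → ℝ := fun i k => 1 / 2 * a₀ i k + 1 / 2 * a₁ i k
  let b : (Fin d → Fin N) → Fin d → ℝ := fun i k => 1 / 2 * b₀ i k + 1 / 2 * b₁ i k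
  have ho : OrderedBoxes a b := fun i j k hij hlt => by
    have h1 := ho₀ i j k hij hlt
    have h2 := ho₁ i j k hij hlt
    simp only [a, b]
    linarith
  have hside : ∀ {ρ : Measure (Ed d)}, ρ ≪ volume → ∀ {lo hi : Fin d → ℝ}, (∀ k, lo k ≤ hi k) →
      ρ.real (box lo hi) = q → ∀ k, 0 < hi k - lo k := by
    intro ρ hρ lo hi hle hb k
    refine (sub_nonneg.2 (hle k)).lt_of_ne' fun h0 => ?_
    have : volume (box lo hi) = 0 := by
      rw [volume_box]
      exact Finset.prod_eq_zero (Finset.mem_univ k) (by simp [h0])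
    rw [Measure.real, hρ this] at hb
    exact hq.ne hb
  have hr₀ : ∀ i k, 0 < b₀ i k - a₀ i k := fun i => hside h₀.1 (fun k => (hab₀ i k).2.1) (hq₀ i)
  have hr₁ : ∀ i k, 0 < b₁ i k - a₁ i k := fun i => hside h₁.1 (fun k => (hab₁ i k).2.1) (hq₁ i)
  have hba : ∀ i k, b i k - a i k = 1 / 2 * (b₀ i k - a₀ i k) + 1 / 2 * (b₁ i k - a₁ i k) :=
    fun i k => by simp only [a, b]; ring
  have hr : ∀ i k, 0 < b i k - a i k := fun i k => by
    rw [hba]; have := hr₀ i k; have := hr₁ i k; positivity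
  have hv₀ : ∀ i, volume.real (box (a₀ i) (b₀ i)) = ∏ k, (b₀ i k - a₀ i k) := fun i =>
    volume_real_box fun k => (hab₀ i k).2.1
  have hv₁ : ∀ i, volume.real (box (a₁ i) (b₁ i)) = ∏ k, (b₁ i k - a₁ i k) := fun i =>
    volume_real_box fun k => (hab₁ i k).2.1
  have hv : ∀ i, volume.real (box (a i) (b i)) = ∏ k, (b i k - a i k) := fun i =>
    volume_real_box fun k => (sub_pos.1 (hr i k)).le
  have hpos : ∀ i, 0 < volume.real (box (a i) (b i)) := fun i => by
    rw [hv]; exact Finset.prod_pos fun k _ => hr i k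
  have hfin : ∀ i, volume (box (a i) (b i)) ≠ ⊤ := fun i => volume_box_ne_top _ _
  have hm : ∀ lo hi : (Fin d → Fin N) → Fin d → ℝ, ∀ i, MeasurableSet (box (lo i) (hi i)) :=
    fun lo hi i => measurableSet_box _ _
  have hone : ∑ _i : Fin d → Fin N, q = 1 := by
    rw [Finset.sum_const, Finset.card_univ, Fintype.card_fun, Fintype.card_fin, Fintype.card_fin,
      nsmul_eq_mul, hq_def, Nat.cast_pow, ← mul_pow, mul_one_div_cancel hN'.ne', one_pow]
  have hone₀ : ∑ i, ρ₀.real (box (a₀ i) (b₀ i)) = 1 := by simp only [hq₀, hone]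
  have hone₁ : ∑ i, ρ₁.real (box (a₁ i) (b₁ i)) = 1 := by simp only [hq₁, hone]
  have hd₀ : Pairwise (Function.onFun Disjoint fun i => box (a₀ i) (b₀ i)) :=
    fun i j hij => ho₀.disjoint hij
  have hd₁ : Pairwise (Function.onFun Disjoint fun i => box (a₁ i) (b₁ i)) :=
    fun i j hij => ho₁.disjoint hij
  have hd : Pairwise (Function.onFun Disjoint fun i => box (a i) (b i)) :=
    fun i j hij => ho.disjoint hij
  let Z := fun i => box (a i) (b i)
  let Θ := blockCoupling q ρ₀ ρ₁ (fun i => box (a₀ i) (b₀ i)) (fun i => box (a₁ i) (b₁ i)) Z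
  have hmap₀ : Θ.map (fun p => p.1.1) = ρ₀ :=
    blockCoupling_map_fst hq hq₁ (hm a₀ b₀) hd₀ hone₀ hfin hpos
  have hmap₁ : Θ.map (fun p => p.1.2) = ρ₁ :=
    blockCoupling_map_snd hq hq₀ (hm a₁ b₁) hd₁ hone₁ hfin hpos
  have hmap : Θ.map (fun p => p.2) = unifMix q Z := blockCoupling_map_mix hq hq₀ hq₁ hfin hpos
  have hΘ : IsProbabilityMeasure Θ := by
    have : IsProbabilityMeasure (Θ.map fun p => p.1.1) := by rw [hmap₀]; infer_instance
    exact Measure.isProbabilityMeasure_of_map fun p => p.1.1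
  have hσ : IsProbabilityMeasure (unifMix q Z) := by
    rw [← hmap]; exact Measure.isProbabilityMeasure_map (by fun_prop)
  obtain ⟨hE, hEv⟩ := unifMix_finiteEnt hq (hm a b) hd hfin hpos
  have hlo : ∀ i k, -L ≤ a i k := fun i k => by
    have h1 := (hab₀ i k).1
    have h2 := (hab₁ i k).1
    simp only [a]
    linarith
  have hhi : ∀ i k, b i k ≤ L := fun i k => by
    have h1 := (hab₀ i k).2.2
    have h2 := (hab₁ i k).2.2
    simp only [b]
    linarith
  refine ⟨unifMix q Z, Θ, unifMix_mem_P2 hlo hhi hσ, hE, ?_, hΘ, hmap₀, hmap₁, hmap, ?_⟩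
  · have e₀ := sum_mul_log_div_le_entR h₀ (hm a₀ b₀) hd₀ hone₀ (fun i => volume_box_ne_top _ _)
      fun i => by rw [hq₀]; exact hq
    have e₁ := sum_mul_log_div_le_entR h₁ (hm a₁ b₁) hd₁ hone₁ (fun i => volume_box_ne_top _ _)
      fun i => by rw [hq₁]; exact hq
    simp only [hq₀, hv₀] at e₀
    simp only [hq₁, hv₁] at e₁
    have h2 : ∑ i, q * Real.log (q / volume.real (box (a i) (b i))) ≤
        1 / 2 * ∑ i, q * Real.log (q / ∏ k, (b₀ i k - a₀ i k)) +
        1 / 2 * ∑ i, q * Real.log (q / ∏ k, (b₁ i k - a₁ i k)) := by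
      rw [Finset.mul_sum, Finset.mul_sum, ← Finset.sum_add_distrib]
      refine Finset.sum_le_sum fun i _ => ?_
      have p₀ := Finset.prod_pos (s := Finset.univ) fun k _ => hr₀ i k
      have p₁ := Finset.prod_pos (s := Finset.univ) fun k _ => hr₁ i k
      rw [Real.log_div hq.ne' (hpos i).ne', Real.log_div hq.ne' p₀.ne',
        Real.log_div hq.ne' p₁.ne', hv]
      simp only [hba]
      have h3 := mul_le_mul_of_nonneg_left
        (half_log_prod_add_half_log_prod_le (hr₀ i) (hr₁ i)) hq.le
      linarith
    have : 0 ≤ d * (2 * L) ^ 2 / N := by positivity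
    rw [hEv]
    linarith
  · have h1 := lintegral_blockCoupling_le (Z := Z) hq hq₀ hq₁ (hm a₀ b₀) (hm a₁ b₁) (hm a b) hfin
      hpos (f := fun p => ‖p.2 - (1 / 2 : ℝ) • (p.1.1 + p.1.2)‖ ^ 2)
      (D := fun i => ∑ k, (b i k - a i k) ^ 2) (fun i => by positivity)
      fun i x hx y hy z hz => norm_sub_midpoint_sq_le hx hy hz
    rw [integral_eq_lintegral_of_nonneg_ae (ae_of_all _ fun p => by positivity)
      (by fun_prop)]
    refine (ENNReal.toReal_le_of_le_ofReal (by positivity) h1).trans ?_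
    rw [← Finset.mul_sum, Finset.sum_comm, Finset.mul_sum]
    have h2 : ∀ k : Fin d, q * ∑ i, (b i k - a i k) ^ 2 ≤ (2 * L) ^ 2 / N := by
      intro k
      have h3 : ∑ i, (b i k - a i k) ^ 2 ≤ ∑ i, 2 * L * (b i k - a i k) := by
        refine Finset.sum_le_sum fun i _ => ?_
        rw [sq]
        have h4 := hlo i k
        have h5 := hhi i k
        exact mul_le_mul_of_nonneg_right (by linarith) (hr i k).le
      rw [← Finset.mul_sum] at h3
      have h4 := mul_le_mul_of_nonneg_left (ho.sum_side_le hL hlo hhi k)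
        (by positivity : 0 ≤ 2 * L)
      have h5 : q * (N : ℝ) ^ (d - 1) = 1 / N := by
        have hd' : d = (d - 1) + 1 := by have := k.2; omega
        rw [hq_def]
        conv_lhs => rw [hd', Nat.add_sub_cancel, pow_succ]
        rw [mul_right_comm, ← mul_pow, one_div_mul_cancel hN'.ne', one_pow, one_mul]
      calc q * ∑ i, (b i k - a i k) ^ 2 ≤ q * (2 * L * (N ^ (d - 1) * (2 * L))) :=
            mul_le_mul_of_nonneg_left (h3.trans h4) hq.le
        _ = (q * (N : ℝ) ^ (d - 1)) * (2 * L) ^ 2 := by ring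
        _ = (2 * L) ^ 2 / N := by rw [h5]; ring
    refine (Finset.sum_le_sum fun k _ => h2 k).trans_eq ?_
    simp
    ring

end BoxMidpoint

section Truncation

open ProbabilityTheory Filter Topology

variable {d : ℕ} {ρ : Measure (Ed d)} {K : Set (Ed d)}

theorem cond_mem_P2 (hρ : ρ ∈ P2 d) (h0 : ρ K ≠ 0) : ρ[|K] ∈ P2 d := by
  have := hρ.1
  refine ⟨cond_isProbabilityMeasure h0, ?_⟩
  rw [ProbabilityTheory.cond]
  exact hρ.2.integrableOn.smul_measure (ENNReal.inv_ne_top.2 h0)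

theorem m2_cond_le (hρ : ρ ∈ P2 d) : m2 ρ[|K] ≤ (ρ.real K)⁻¹ * m2 ρ := by
  rw [m2, ProbabilityTheory.cond, integral_smul_measure, smul_eq_mul, ENNReal.toReal_inv]
  exact mul_le_mul_of_nonneg_left
    (setIntegral_le_integral hρ.2 (ae_of_all _ fun x => by positivity)) (by positivity)

theorem cond_finiteEnt [IsProbabilityMeasure ρ] (h : FiniteEnt ρ) (hK : MeasurableSet K)
    (h0 : 0 < ρ.real K) :
    FiniteEnt ρ[|K] ∧
      entR ρ[|K] = (ρ.real K)⁻¹ * (∫ x in K, entFn ρ x) - Real.log (ρ.real K) := by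
  set m := ρ.real K
  let g : Ed d → ℝ := fun x => (ρ.rnDeriv volume x).toReal
  have hg : Measurable g := (Measure.measurable_rnDeriv _ _).ennreal_toReal
  have hgi : Integrable g volume := Measure.integrable_toReal_rnDeriv
  let f : Ed d → ℝ := K.indicator fun x => m⁻¹ * g x
  have hf : Measurable f := (hg.const_mul _).indicator hK
  have hf0 : ∀ x, 0 ≤ f x := fun x =>
    Set.indicator_nonneg (fun x _ => mul_nonneg (inv_nonneg.2 h0.le) toReal_nonneg) x
  have hm : (ρ K)⁻¹ = ENNReal.ofReal m⁻¹ := by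
    rw [ENNReal.ofReal_inv_of_pos h0, ofReal_measureReal]
  have hc : ρ[|K] = volume.withDensity fun x => ENNReal.ofReal (f x) := by
    have h1 : (fun x => ENNReal.ofReal (f x)) =
        K.indicator fun x => ENNReal.ofReal (m⁻¹ * g x) := by
      ext x
      by_cases hx : x ∈ K <;> simp [f, hx]
    have h2 : volume.withDensity (fun x => ENNReal.ofReal (g x)) = ρ := by
      rw [withDensity_congr_ae (g := ρ.rnDeriv volume), Measure.withDensity_rnDeriv_eq _ _ h.1]
      filter_upwards [Measure.rnDeriv_lt_top ρ volume] with x hx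
      exact ENNReal.ofReal_toReal hx.ne
    rw [h1, withDensity_indicator hK]
    have h3 : (fun x => ENNReal.ofReal (m⁻¹ * g x)) =
        ENNReal.ofReal m⁻¹ • fun x => ENNReal.ofReal (g x) := by
      ext x
      rw [Pi.smul_apply, smul_eq_mul, ENNReal.ofReal_mul (inv_nonneg.2 h0.le)]
    rw [h3, withDensity_smul _ hg.ennreal_ofReal, ← restrict_withDensity hK, h2,
      ProbabilityTheory.cond, hm]
  have hlog : ∀ x, f x * Real.log (f x) =
      K.indicator (fun x => m⁻¹ * entFn ρ x - m⁻¹ * Real.log m * g x) x := by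
    intro x
    by_cases hx : x ∈ K
    · simp only [f, Set.indicator_of_mem hx, entFn]
      change m⁻¹ * g x * Real.log (m⁻¹ * g x) =
        m⁻¹ * (g x * Real.log (g x)) - m⁻¹ * Real.log m * g x
      rcases eq_or_ne (g x) 0 with h0' | h0'
      · simp [h0']
      · rw [Real.log_mul (inv_ne_zero h0.ne') h0', Real.log_inv]
        ring
    · simp [f, Set.indicator_of_notMem hx]
  have hae : entFn ρ[|K] =ᵐ[volume]
      K.indicator fun x => m⁻¹ * entFn ρ x - m⁻¹ * Real.log m * g x := by
    rw [hc]
    exact (entFn_withDensity hf hf0).trans (ae_of_all _ hlog)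
  have i1 : IntegrableOn (fun x => m⁻¹ * entFn ρ x) K volume := (h.2.const_mul _).integrableOn
  have i2 : IntegrableOn (fun x => m⁻¹ * Real.log m * g x) K volume :=
    (hgi.const_mul _).integrableOn
  refine ⟨⟨?_, ((integrable_indicator_iff hK).2 (i1.sub i2)).congr hae.symm⟩, ?_⟩
  · rw [hc]; exact withDensity_absolutelyContinuous _ _
  · rw [entR, integral_congr_ae hae, integral_indicator hK, integral_sub i1 i2,
      integral_const_mul, integral_const_mul, Measure.setIntegral_toReal_rnDeriv h.1]
    change _ - _ * m = _
    field_simp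

theorem exists_coupling_cond (hρ : ρ ∈ P2 d) (hK : MeasurableSet K) (h0 : 0 < ρ.real K) :
    ∃ δ ∈ couplings ρ ρ[|K], ∫ p, ‖p.1 - p.2‖ ^ 2 ∂δ ≤
      2 * ∫ x in Kᶜ, ‖x‖ ^ 2 ∂ρ + 2 * ((1 - ρ.real K) * ((ρ.real K)⁻¹ * m2 ρ)) := by
  have := hρ.1
  have h0' : ρ K ≠ 0 := fun h => by simp [Measure.real, h] at h0
  have hc := cond_mem_P2 hρ h0'
  have := hc.1
  have hdiag : Measurable fun x : Ed d => (x, x) := by fun_prop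
  let δ₁ := (ρ.restrict K).map fun x => (x, x)
  let δ₂ := (ρ.restrict Kᶜ).prod ρ[|K]
  have hfst : (δ₁ + δ₂).map Prod.fst = ρ := by
    rw [Measure.map_add _ _ measurable_fst, Measure.map_map measurable_fst hdiag,
      Measure.map_fst_prod, measure_univ, one_smul]
    change (ρ.restrict K).map id + ρ.restrict Kᶜ = ρ
    rw [Measure.map_id, Measure.restrict_add_restrict_compl hK]
  have hsnd : (δ₁ + δ₂).map Prod.snd = ρ[|K] := by
    rw [Measure.map_add _ _ measurable_snd, Measure.map_map measurable_snd hdiag,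
      Measure.map_snd_prod, Measure.restrict_apply_univ]
    change (ρ.restrict K).map id + _ = _
    have h1 : ρ.restrict K = ρ K • ρ[|K] := by
      rw [ProbabilityTheory.cond, smul_smul, ENNReal.mul_inv_cancel h0' (measure_ne_top _ _),
        one_smul]
    rw [Measure.map_id, h1, ← add_smul, prob_add_prob_compl hK, one_smul]
  have hδ : IsProbabilityMeasure (δ₁ + δ₂) := by
    have : IsProbabilityMeasure ((δ₁ + δ₂).map Prod.fst) := by rw [hfst]; infer_instance
    exact Measure.isProbabilityMeasure_of_map Prod.fst
  have hmem : δ₁ + δ₂ ∈ couplings ρ ρ[|K] := ⟨hδ, hfst, hsnd⟩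
  refine ⟨δ₁ + δ₂, hmem, ?_⟩
  have hi : Integrable (fun p : Ed d × Ed d => ‖p.1 - p.2‖ ^ 2) (δ₁ + δ₂) :=
    ((memLp_fst hmem hρ).sub (memLp_snd hmem hc)).integrable_norm_pow (by norm_num)
  rw [integrable_add_measure] at hi
  rw [integral_add_measure hi.1 hi.2]
  have e1 : ∫ p, ‖p.1 - p.2‖ ^ 2 ∂δ₁ = 0 := by
    rw [integral_map hdiag.aemeasurable (by fun_prop)]
    simp
  have ix : Integrable (fun p : Ed d × Ed d => 2 * ‖p.1‖ ^ 2) δ₂ :=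
    ((memLp_fst hmem hρ).integrable_norm_pow (by norm_num)).right_of_add_measure.const_mul 2
  have iy : Integrable (fun p : Ed d × Ed d => 2 * ‖p.2‖ ^ 2) δ₂ :=
    ((memLp_snd hmem hc).integrable_norm_pow (by norm_num)).right_of_add_measure.const_mul 2
  have e2 : ∫ p, ‖p.1 - p.2‖ ^ 2 ∂δ₂ ≤ ∫ p, (2 * ‖p.1‖ ^ 2 + 2 * ‖p.2‖ ^ 2) ∂δ₂ :=
    integral_mono hi.2 (ix.add iy) fun p => by
      have := parallelogram_law_with_norm ℝ p.1 p.2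
      have := sq_nonneg ‖p.1 + p.2‖
      simp only
      nlinarith
  have e3 : ∫ p, ‖p.1‖ ^ 2 ∂δ₂ = ∫ x in Kᶜ, ‖x‖ ^ 2 ∂ρ := by
    rw [integral_fun_fst (fun x : Ed d => ‖x‖ ^ 2)]
    simp
  have e4 : ∫ p, ‖p.2‖ ^ 2 ∂δ₂ = (1 - ρ.real K) * m2 ρ[|K] := by
    rw [integral_fun_snd (fun x : Ed d => ‖x‖ ^ 2), measureReal_restrict_apply_univ,
      probReal_compl_eq_one_sub hK]
    rfl
  rw [integral_add ix iy, integral_const_mul, integral_const_mul, e3, e4] at e2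
  have e5 := mul_le_mul_of_nonneg_left (m2_cond_le (K := K) hρ)
    (sub_nonneg.2 (measureReal_le_one (μ := ρ) (s := K)))
  linarith

theorem eventually_truncation (hρ : ρ ∈ P2 d) (h : FiniteEnt ρ) {ε : ℝ} (hε : 0 < ε) :
    ∀ᶠ n : ℕ in atTop, ∃ ρ' : Measure (Ed d), ρ' ∈ P2 d ∧ FiniteEnt ρ' ∧
      entR ρ' ≤ entR ρ + ε ∧ ρ'.real (box (fun _ => -(n : ℝ)) (fun _ => (n : ℝ))) = 1 ∧
      ∃ δ ∈ couplings ρ ρ', ∫ p, ‖p.1 - p.2‖ ^ 2 ∂δ ≤ ε := by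
  have := hρ.1
  let K : ℕ → Set (Ed d) := fun n => box (fun _ => -(n : ℝ)) (fun _ => (n : ℝ))
  have hKm : ∀ n, MeasurableSet (K n) := fun n => measurableSet_box _ _
  have hmono : Monotone K := by
    intro i j hij x hx k
    have hx' := hx k
    have : (i : ℝ) ≤ j := by exact_mod_cast hij
    constructor <;> linarith
  have hU : ⋃ n, K n = Set.univ := by
    refine Set.eq_univ_of_forall fun x => ?_
    obtain ⟨n, hn⟩ := exists_nat_gt ‖x‖
    refine Set.mem_iUnion.2 ⟨n, fun k => ?_⟩
    have h1 := (PiLp.norm_apply_le x k).trans_lt hn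
    rw [Real.norm_eq_abs, abs_lt] at h1
    exact ⟨h1.1, h1.2.le⟩
  have hlim : ∀ {m : Measure (Ed d)} {f : Ed d → ℝ}, Integrable f m →
      Tendsto (fun n => ∫ x in K n, f x ∂m) atTop (𝓝 (∫ x, f x ∂m)) := by
    intro m f hf
    have := tendsto_setIntegral_of_monotone hKm hmono (μ := m) (f := f) hf.integrableOn
    rwa [hU, setIntegral_univ] at this
  have hm : Tendsto (fun n => ρ.real (K n)) atTop (𝓝 1) := by
    have := hlim (m := ρ) (integrable_const (1 : ℝ))
    simpa using this
  have hE : Tendsto (fun n => (ρ.real (K n))⁻¹ * (∫ x in K n, entFn ρ x) -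
      Real.log (ρ.real (K n))) atTop (𝓝 (entR ρ)) := by
    have := ((hm.inv₀ one_ne_zero).mul (hlim h.2)).sub (hm.log one_ne_zero)
    simpa [entR] using this
  have hC : Tendsto (fun n => 2 * (∫ x in (K n)ᶜ, ‖x‖ ^ 2 ∂ρ) +
      2 * ((1 - ρ.real (K n)) * ((ρ.real (K n))⁻¹ * m2 ρ))) atTop (𝓝 0) := by
    have h1 : Tendsto (fun n => ∫ x in (K n)ᶜ, ‖x‖ ^ 2 ∂ρ) atTop (𝓝 0) := by
      have h2 : ∀ n, ∫ x in (K n)ᶜ, ‖x‖ ^ 2 ∂ρ = m2 ρ - ∫ x in K n, ‖x‖ ^ 2 ∂ρ := fun n => by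
        rw [m2, ← integral_add_compl (hKm n) hρ.2]; ring
      simp only [h2]
      have := (tendsto_const_nhds (x := m2 ρ)).sub (hlim hρ.2)
      simpa [m2] using this
    have := (h1.const_mul 2).add ((((tendsto_const_nhds (x := (1 : ℝ))).sub hm).mul
      ((hm.inv₀ one_ne_zero).mul_const (m2 ρ))).const_mul 2)
    simpa using this
  filter_upwards [hm.eventually (lt_mem_nhds zero_lt_one),
    hE.eventually (gt_mem_nhds (lt_add_of_pos_right _ hε)),
    hC.eventually (gt_mem_nhds hε)] with n h1 h2 h3
  have h0' : ρ (K n) ≠ 0 := fun h => by simp [Measure.real, h] at h1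
  obtain ⟨f1, f2⟩ := cond_finiteEnt h (hKm n) h1
  obtain ⟨δ, hδ, hδc⟩ := exists_coupling_cond hρ (hKm n) h1
  refine ⟨ρ[|K n], cond_mem_P2 hρ h0', f1, f2.trans_le h2.le, ?_, δ, hδ, hδc.trans h3.le⟩
  change (ρ[|K n]).real (K n) = 1
  rw [Measure.real, cond_apply_self h0', ENNReal.toReal_one]
  exact measure_ne_top _ _

end Truncation

section Stability

open Filter Topology

variable {d : ℕ}

theorem norm_sub_midpoint_sq_le_of_approx (x₀ x₁ y₀ y₁ z : Ed d) :
    ‖z - (1 / 2 : ℝ) • (x₀ + x₁)‖ ^ 2 ≤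
      3 * ‖z - (1 / 2 : ℝ) • (y₀ + y₁)‖ ^ 2 + ‖y₀ - x₀‖ ^ 2 + ‖y₁ - x₁‖ ^ 2 := by
  have h1 : z - (1 / 2 : ℝ) • (x₀ + x₁) = (z - (1 / 2 : ℝ) • (y₀ + y₁)) +
      ((1 / 2 : ℝ) • (y₀ - x₀) + (1 / 2 : ℝ) • (y₁ - x₁)) := by
    simp only [smul_add, smul_sub]; abel
  have h2 : ‖z - (1 / 2 : ℝ) • (x₀ + x₁)‖ ≤ ‖z - (1 / 2 : ℝ) • (y₀ + y₁)‖ +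
      (1 / 2 * ‖y₀ - x₀‖ + 1 / 2 * ‖y₁ - x₁‖) := by
    rw [h1]
    refine (norm_add_le _ _).trans ?_
    gcongr
    refine (norm_add_le _ _).trans_eq ?_
    rw [norm_smul, norm_smul]
    norm_num
  refine (pow_le_pow_left₀ (norm_nonneg _) h2 2).trans ?_
  set a := ‖z - (1 / 2 : ℝ) • (y₀ + y₁)‖
  set b := ‖y₀ - x₀‖
  set c := ‖y₁ - x₁‖
  nlinarith [sq_nonneg (2 * a - b), sq_nonneg (2 * a - c), sq_nonneg (b - c), sq_nonneg a,
    sq_nonneg b, sq_nonneg c]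

theorem HasApproxMidpoint.of_near {ρ₀ ρ₁ ρ₀' ρ₁' : Measure (Ed d)} (h₀ : ρ₀ ∈ P2 d)
    (h₁ : ρ₁ ∈ P2 d) (h₀' : ρ₀' ∈ P2 d) (h₁' : ρ₁' ∈ P2 d) {ε : ℝ} (hε : 0 ≤ ε)
    (hE₀ : entR ρ₀' ≤ entR ρ₀ + ε) (hE₁ : entR ρ₁' ≤ entR ρ₁ + ε)
    {δ₀ δ₁ : Measure (Ed d × Ed d)} (hδ₀ : δ₀ ∈ couplings ρ₀ ρ₀') (hδ₁ : δ₁ ∈ couplings ρ₁ ρ₁')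
    (hc₀ : ∫ p, ‖p.1 - p.2‖ ^ 2 ∂δ₀ ≤ ε) (hc₁ : ∫ p, ‖p.1 - p.2‖ ^ 2 ∂δ₁ ≤ ε)
    (h : HasApproxMidpoint ρ₀' ρ₁' ε) : HasApproxMidpoint ρ₀ ρ₁ (5 * ε) := by
  obtain ⟨σ, Θ, hσ, hσE, hE, hΘ, hx, hy, hz, hc⟩ := h
  have := hδ₀.1
  have := hδ₁.1
  have hsw : Measurable (Prod.swap : Ed d × Ed d → Ed d × Ed d) := measurable_swap
  have := Measure.isProbabilityMeasure_map (μ := δ₀) hsw.aemeasurable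
  have := Measure.isProbabilityMeasure_map (μ := δ₁) hsw.aemeasurable
  have hf₀ : (δ₀.map Prod.swap).map Prod.fst = ρ₀' := by
    rw [Measure.map_map measurable_fst hsw, ← hδ₀.2.2]; rfl
  have hf₁ : (δ₁.map Prod.swap).map Prod.fst = ρ₁' := by
    rw [Measure.map_map measurable_fst hsw, ← hδ₁.2.2]; rfl
  obtain ⟨P, hP, hP1, hP2⟩ := exists_gluing Θ (f := fun p => p.1.1) (by fun_prop)
    (δ₀.map Prod.swap) (by rw [hf₀, hx])
  have hPy : P.map (fun p => p.1.1.2) = ρ₁' := by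
    rw [← hy, ← hP1, Measure.map_map (by fun_prop) measurable_fst]; rfl
  obtain ⟨Q, hQ, hQ1, hQ2⟩ := exists_gluing P (f := fun p => p.1.1.2) (by fun_prop)
    (δ₁.map Prod.swap) (by rw [hf₁, hPy])
  have hQΘ : Q.map (fun p => p.1.1) = Θ := by
    rw [← hP1, ← hQ1, Measure.map_map measurable_fst measurable_fst]; rfl
  have hQ0 : Q.map (fun p => (p.1.2, p.1.1.1.1)) = δ₀ := by
    have e : δ₀ = (δ₀.map Prod.swap).map Prod.swap := by
      rw [Measure.map_map hsw hsw, Prod.swap_swap_eq, Measure.map_id]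
    rw [e, ← hP2, ← hQ1, Measure.map_map (by fun_prop) measurable_fst,
      Measure.map_map hsw (by fun_prop)]
    rfl
  have hQ3 : Q.map (fun p => (p.2, p.1.1.1.2)) = δ₁ := by
    have e : δ₁ = (δ₁.map Prod.swap).map Prod.swap := by
      rw [Measure.map_map hsw hsw, Prod.swap_swap_eq, Measure.map_id]
    rw [e, ← hQ2, Measure.map_map hsw (by fun_prop)]
    rfl
  have mx : Q.map (fun p => p.1.2) = ρ₀ := by
    rw [← hδ₀.2.1, ← hQ0, Measure.map_map measurable_fst (by fun_prop)]; rfl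
  have my : Q.map (fun p => p.2) = ρ₁ := by
    rw [← hδ₁.2.1, ← hQ3, Measure.map_map measurable_fst (by fun_prop)]; rfl
  have mx' : Q.map (fun p => p.1.1.1.1) = ρ₀' := by
    rw [← hδ₀.2.2, ← hQ0, Measure.map_map measurable_snd (by fun_prop)]; rfl
  have my' : Q.map (fun p => p.1.1.1.2) = ρ₁' := by
    rw [← hδ₁.2.2, ← hQ3, Measure.map_map measurable_snd (by fun_prop)]; rfl
  have mz : Q.map (fun p => p.1.1.2) = σ := by
    rw [← hz, ← hQΘ, Measure.map_map (by fun_prop) (by fun_prop)]; rfl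
  have lx : MemLp (fun p : (((Ed d × Ed d) × Ed d) × Ed d) × Ed d => p.1.2) 2 Q :=
    memLp_of_mem_P2 (by fun_prop) (by rwa [mx])
  have ly : MemLp (fun p : (((Ed d × Ed d) × Ed d) × Ed d) × Ed d => p.2) 2 Q :=
    memLp_of_mem_P2 (by fun_prop) (by rwa [my])
  have lx' : MemLp (fun p : (((Ed d × Ed d) × Ed d) × Ed d) × Ed d => p.1.1.1.1) 2 Q :=
    memLp_of_mem_P2 (by fun_prop) (by rwa [mx'])
  have ly' : MemLp (fun p : (((Ed d × Ed d) × Ed d) × Ed d) × Ed d => p.1.1.1.2) 2 Q :=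
    memLp_of_mem_P2 (by fun_prop) (by rwa [my'])
  have lz : MemLp (fun p : (((Ed d × Ed d) × Ed d) × Ed d) × Ed d => p.1.1.2) 2 Q :=
    memLp_of_mem_P2 (by fun_prop) (by rwa [mz])
  have hΛ : Measurable (fun p : (((Ed d × Ed d) × Ed d) × Ed d) × Ed d =>
      ((p.1.2, p.2), p.1.1.2)) := by fun_prop
  refine ⟨σ, Q.map fun p => ((p.1.2, p.2), p.1.1.2), hσ, hσE, by linarith,
    Measure.isProbabilityMeasure_map hΛ.aemeasurable, ?_, ?_, ?_, ?_⟩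
  · rw [Measure.map_map (by fun_prop) hΛ]; exact mx
  · rw [Measure.map_map (by fun_prop) hΛ]; exact my
  · rw [Measure.map_map (by fun_prop) hΛ]; exact mz
  · rw [integral_map hΛ.aemeasurable (by fun_prop)]
    rw [← hQΘ, integral_map (by fun_prop) (by fun_prop)] at hc
    rw [← hQ0, integral_map (by fun_prop) (by fun_prop)] at hc₀
    rw [← hQ3, integral_map (by fun_prop) (by fun_prop)] at hc₁
    have i1 : Integrable (fun p : (((Ed d × Ed d) × Ed d) × Ed d) × Ed d =>
        ‖p.1.1.2 - (1 / 2 : ℝ) • (p.1.2 + p.2)‖ ^ 2) Q :=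
      (lz.sub ((lx.add ly).const_smul (1 / 2 : ℝ))).integrable_norm_pow (by norm_num)
    have i2 : Integrable (fun p : (((Ed d × Ed d) × Ed d) × Ed d) × Ed d =>
        3 * ‖p.1.1.2 - (1 / 2 : ℝ) • (p.1.1.1.1 + p.1.1.1.2)‖ ^ 2) Q :=
      ((lz.sub ((lx'.add ly').const_smul (1 / 2 : ℝ))).integrable_norm_pow
        (by norm_num)).const_mul 3
    have i3 : Integrable (fun p : (((Ed d × Ed d) × Ed d) × Ed d) × Ed d =>
        ‖p.1.2 - p.1.1.1.1‖ ^ 2) Q := (lx.sub lx').integrable_norm_pow (by norm_num)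
    have i4 : Integrable (fun p : (((Ed d × Ed d) × Ed d) × Ed d) × Ed d =>
        ‖p.2 - p.1.1.1.2‖ ^ 2) Q := (ly.sub ly').integrable_norm_pow (by norm_num)
    have i5 : Integrable (fun p : (((Ed d × Ed d) × Ed d) × Ed d) × Ed d =>
        3 * ‖p.1.1.2 - (1 / 2 : ℝ) • (p.1.1.1.1 + p.1.1.1.2)‖ ^ 2 + ‖p.1.2 - p.1.1.1.1‖ ^ 2) Q :=
      i2.add i3
    have hle := integral_mono i1 (i5.add i4) fun p => by
      have := norm_sub_midpoint_sq_le_of_approx p.1.2 p.2 p.1.1.1.1 p.1.1.1.2 p.1.1.2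
      rwa [norm_sub_rev p.1.1.1.1, norm_sub_rev p.1.1.1.2] at this
    simp only [Pi.add_apply] at hle
    rw [integral_add i5 i4, integral_add i2 i3, integral_const_mul] at hle
    simp only at hc hc₀ hc₁ ⊢
    linarith

theorem hasApproxMidpoint {ρ₀ ρ₁ : Measure (Ed d)} (h₀ : ρ₀ ∈ P2 d) (h₁ : ρ₁ ∈ P2 d)
    (hE₀ : FiniteEnt ρ₀) (hE₁ : FiniteEnt ρ₁) {ε : ℝ} (hε : 0 < ε) :
    HasApproxMidpoint ρ₀ ρ₁ ε := by
  have hε' : 0 < ε / 5 := by positivity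
  obtain ⟨n, ⟨ρ₀', h₀', e₀, b₀, s₀, δ₀, m₀, c₀⟩, ρ₁', h₁', e₁, b₁, s₁, δ₁, m₁, c₁⟩ :=
    ((eventually_truncation h₀ hE₀ hε').and (eventually_truncation h₁ hE₁ hε')).exists
  have := h₀'.1
  have := h₁'.1
  obtain ⟨N, hN⟩ := exists_nat_gt (d * (2 * (n : ℝ)) ^ 2 / (ε / 5))
  have hN0 : (0 : ℝ) < N := lt_of_le_of_lt (by positivity) hN
  have hN1 : d * (2 * (n : ℝ)) ^ 2 / N ≤ ε / 5 := by
    rw [div_lt_iff₀ hε'] at hN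
    rw [div_le_iff₀ hN0]
    linarith
  obtain ⟨σ, Θ, a1, a2, a3, a4, a5, a6, a7, a8⟩ := hasApproxMidpoint_of_box e₀ e₁ n.cast_nonneg
    s₀ s₁ (N := N) (by exact_mod_cast hN0)
  have := HasApproxMidpoint.of_near h₀ h₁ h₀' h₁' hε'.le b₀ b₁ m₀ m₁ c₀ c₁
    ⟨σ, Θ, a1, a2, a3.trans (by linarith), a4, a5, a6, a7, a8.trans hN1⟩
  rwa [mul_div_cancel₀ ε (by norm_num : (5 : ℝ) ≠ 0)] at this

theorem integrable_cost {ρ μ : Measure (Ed d)} (hρ : ρ ∈ P2 d) (hμ : μ ∈ P2 d)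
    {γ : Measure (Ed d × Ed d)} (hγ : γ ∈ couplings ρ μ) :
    Integrable (fun p => ‖p.1 - p.2‖ ^ 2) γ :=
  ((memLp_fst hγ hρ).sub (memLp_snd hγ hμ)).integrable_norm_pow (by norm_num)

theorem lintegral_cost {ρ μ : Measure (Ed d)} (hρ : ρ ∈ P2 d) (hμ : μ ∈ P2 d)
    {γ : Measure (Ed d × Ed d)} (hγ : γ ∈ couplings ρ μ) :
    ∫⁻ p, ENNReal.ofReal (‖p.1 - p.2‖ ^ 2) ∂γ = ENNReal.ofReal (∫ p, ‖p.1 - p.2‖ ^ 2 ∂γ) :=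
  (ofReal_integral_eq_lintegral_ofReal (integrable_cost hρ hμ hγ)
    (ae_of_all _ fun p => by positivity)).symm

theorem W2_sq_le {ρ μ : Measure (Ed d)} (hρ : ρ ∈ P2 d) (hμ : μ ∈ P2 d)
    {γ : Measure (Ed d × Ed d)} (hγ : γ ∈ couplings ρ μ) :
    W2 ρ μ ^ 2 ≤ ∫ p, ‖p.1 - p.2‖ ^ 2 ∂γ := by
  rw [W2, Real.sq_sqrt toReal_nonneg]
  refine ENNReal.toReal_le_of_le_ofReal (integral_nonneg fun p => by positivity) ?_
  rw [← lintegral_cost hρ hμ hγ]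
  exact iInf₂_le γ hγ

theorem exists_coupling_le {ρ μ : Measure (Ed d)} (hρ : ρ ∈ P2 d) (hμ : μ ∈ P2 d) {ε : ℝ}
    (hε : 0 < ε) : ∃ γ ∈ couplings ρ μ, ∫ p, ‖p.1 - p.2‖ ^ 2 ∂γ ≤ W2 ρ μ ^ 2 + ε := by
  have := hρ.1
  have := hμ.1
  rw [W2, Real.sq_sqrt toReal_nonneg]
  set I := ⨅ γ ∈ couplings ρ μ, ∫⁻ p, ENNReal.ofReal (‖p.1 - p.2‖ ^ 2) ∂γ with hI
  have hfin : I ≠ ⊤ := by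
    refine ne_top_of_le_ne_top ?_ (iInf₂_le (ρ.prod μ) prod_mem_couplings)
    rw [lintegral_cost hρ hμ prod_mem_couplings]
    exact ofReal_ne_top
  have hlt : I < ENNReal.ofReal (I.toReal + ε) := by
    rw [ENNReal.lt_ofReal_iff_toReal_lt hfin]
    linarith
  conv_lhs at hlt => rw [hI]
  simp only [iInf_lt_iff] at hlt
  obtain ⟨γ, hγ, hlt⟩ := hlt
  refine ⟨γ, hγ, ?_⟩
  rw [lintegral_cost hρ hμ hγ] at hlt
  exact (ENNReal.ofReal_lt_ofReal_iff_of_nonneg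
    (integral_nonneg fun p => by positivity)).1 hlt |>.le

theorem swap_mem_couplings {ρ μ : Measure (Ed d)} {γ : Measure (Ed d × Ed d)}
    (hγ : γ ∈ couplings ρ μ) : γ.map Prod.swap ∈ couplings μ ρ ∧
      ∫ p, ‖p.1 - p.2‖ ^ 2 ∂(γ.map Prod.swap) = ∫ p, ‖p.1 - p.2‖ ^ 2 ∂γ := by
  have := hγ.1
  constructor
  · have := map_mem_couplings (P := γ) measurable_snd measurable_fst
    rwa [hγ.2.1, hγ.2.2] at this
  · rw [integral_map measurable_swap.aemeasurable (by fun_prop)]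
    simp only [Prod.fst_swap, Prod.snd_swap, norm_sub_rev]

theorem W2_comm (ρ μ : Measure (Ed d)) : W2 ρ μ = W2 μ ρ := by
  have key : ∀ ρ μ : Measure (Ed d),
      (⨅ γ ∈ couplings ρ μ, ∫⁻ p, ENNReal.ofReal (‖p.1 - p.2‖ ^ 2) ∂γ) ≤
        ⨅ γ ∈ couplings μ ρ, ∫⁻ p, ENNReal.ofReal (‖p.1 - p.2‖ ^ 2) ∂γ := by
    refine fun ρ μ => le_iInf₂ fun γ hγ => (iInf₂_le _ (swap_mem_couplings hγ).1).trans_eq ?_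
    rw [lintegral_map (by fun_prop) measurable_swap]
    simp only [Prod.fst_swap, Prod.snd_swap, norm_sub_rev]
  rw [W2, W2, le_antisymm (key ρ μ) (key μ ρ)]

/-- Strong convexity of `F_μ` along generalized geodesics, evaluated at a minimizer. -/
theorem FR_add_W2_sq_le {α : ℝ} (hα : 0 < α) {μ ρ₀ ρ₁ : Measure (Ed d)} (hμ : μ ∈ P2 d)
    (h₀ : ρ₀ ∈ P2 d) (h₁ : ρ₁ ∈ P2 d) (hE₀ : FiniteEnt ρ₀) (hE₁ : FiniteEnt ρ₁)
    (hmin : ∀ σ : Measure (Ed d), σ ∈ P2 d → FiniteEnt σ → FR α μ ρ₀ ≤ FR α μ σ) :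
    FR α μ ρ₀ + α / 4 * W2 ρ₀ ρ₁ ^ 2 ≤ FR α μ ρ₁ := by
  set A := 1 / 2 * m2 ρ₀ + 1 / 2 * m2 ρ₁ with hA
  have hA0 : 0 ≤ A := by
    have := m2_nonneg ρ₀; have := m2_nonneg ρ₁; positivity
  set K := 1 + Real.sqrt (m2 μ) + α * (A + 3) with hK
  have hK0 : 0 < K := by positivity
  have key : ∀ s : ℝ, 0 < s → s ≤ 1 →
      FR α μ ρ₀ + α / 4 * W2 ρ₀ ρ₁ ^ 2 ≤ FR α μ ρ₁ + 2 * (K * s) := by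
    intro s hs hs1
    obtain ⟨σ, Θ, hσ, hσE, hE, hΘ, hx, hy, hz, hc⟩ :=
      hasApproxMidpoint h₀ h₁ hE₀ hE₁ (ε := s ^ 2) (by positivity)
    have c1 := corr_approx_midpoint_le h₀ h₁ hσ hμ hx hy hz
    have c2 := m2_approx_midpoint_le h₀ h₁ hσ hx hy hz
    have hsq := (Real.sqrt_le_sqrt hc).trans_eq (Real.sqrt_sq hs.le)
    set e := Real.sqrt (∫ p, ‖p.2 - (1 / 2 : ℝ) • (p.1.1 + p.1.2)‖ ^ 2 ∂Θ)
    set t := Real.sqrt (m2 σ) with ht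
    have ht0 : 0 ≤ t := Real.sqrt_nonneg _
    have htt : t ^ 2 = m2 σ := Real.sq_sqrt (m2_nonneg σ)
    have hW : W2 ρ₀ ρ₁ ^ 2 ≤ ∫ p, ‖p.1.1 - p.1.2‖ ^ 2 ∂Θ := by
      have hm := map_mem_couplings (P := Θ) (X := fun p => p.1.1) (Y := fun p => p.1.2)
        (by fun_prop) (by fun_prop)
      rw [hx, hy] at hm
      have := W2_sq_le h₀ h₁ hm
      rwa [integral_map (by fun_prop) (by fun_prop)] at this
    have het : e * t ≤ s * t := mul_le_mul_of_nonneg_right hsq ht0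
    have hem : e * Real.sqrt (m2 μ) ≤ s * Real.sqrt (m2 μ) :=
      mul_le_mul_of_nonneg_right hsq (Real.sqrt_nonneg _)
    have htA : t ≤ A + 3 := by
      have h1 : s * t ≤ t := mul_le_of_le_one_left ht0 hs1
      have h2 : t ^ 2 ≤ A + 2 * t := by
        have := sq_nonneg (W2 ρ₀ ρ₁)
        rw [htt]; linarith
      by_contra! hlt
      nlinarith
    have hst : s * t ≤ s * (A + 3) := mul_le_mul_of_nonneg_left htA hs.le
    have hss : s ^ 2 ≤ s := by nlinarith
    have hF := hmin σ hσ hσE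
    have c3 : m2 σ ≤ A - 1 / 4 * W2 ρ₀ ρ₁ ^ 2 + 2 * (s * (A + 3)) := by linarith
    have c4 := mul_le_mul_of_nonneg_left c3 (by positivity : 0 ≤ α / 2)
    have c5 : FR α μ σ ≤ 1 / 2 * FR α μ ρ₀ + 1 / 2 * FR α μ ρ₁ - α / 8 * W2 ρ₀ ρ₁ ^ 2 + K * s := by
      simp only [FR, hK]
      simp only [hA] at c4 ⊢
      linarith
    linarith
  refine le_of_forall_pos_le_add fun η hη => ?_
  refine (key (min 1 (η / (2 * K))) (by positivity) (min_le_left _ _)).trans ?_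
  have h1 := mul_le_mul_of_nonneg_left (min_le_right 1 (η / (2 * K)))
    (by positivity : 0 ≤ 2 * K)
  rw [mul_div_cancel₀ η (by positivity)] at h1
  linarith

theorem W2_nonneg (ρ μ : Measure (Ed d)) : 0 ≤ W2 ρ μ := Real.sqrt_nonneg _

theorem W2_minimizers_sq_le {α : ℝ} (hα : 0 < α) {R : ℝ} {μ ν ρμ ρν : Measure (Ed d)}
    (hμ : μ ∈ P2 d) (hν : ν ∈ P2 d) (hρμ : IsMinOfF α μ ρμ) (hρν : IsMinOfF α ν ρν)
    (hRμ : m2 ρμ ≤ R) (hRν : m2 ρν ≤ R) :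
    W2 ρμ ρν ^ 2 ≤ 4 * Real.sqrt R / α * W2 μ ν := by
  obtain ⟨h₀, hE₀⟩ := hρμ.finite hα hμ
  obtain ⟨h₁, hE₁⟩ := hρν.finite hα hν
  have f1 := FR_add_W2_sq_le hα hμ h₀ h₁ hE₀ hE₁ fun σ h h' => hρμ.FR_le hα hμ h h'
  have f2 := FR_add_W2_sq_le hα hν h₁ h₀ hE₁ hE₀ fun σ h h' => hρν.FR_le hα hν h h'
  rw [W2_comm ρν ρμ] at f2
  have hw := W2_nonneg μ ν
  have key : ∀ s : ℝ, 0 < s → α / 2 * W2 ρμ ρν ^ 2 ≤ 2 * Real.sqrt R * (W2 μ ν + s) := by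
    intro s hs
    obtain ⟨η, hη, hc⟩ := exists_coupling_le hμ hν (ε := s ^ 2) (by positivity)
    obtain ⟨hη', hc'⟩ := swap_mem_couplings hη
    have g1 := corr_le_corr_add h₁ hμ hν hη
    have g2 := corr_le_corr_add h₀ hν hμ hη'
    rw [hc'] at g2
    have hc2 : Real.sqrt (∫ p, ‖p.1 - p.2‖ ^ 2 ∂η) ≤ W2 μ ν + s :=
      Real.sqrt_le_iff.2 ⟨by positivity, hc.trans (by nlinarith)⟩
    have k1 := mul_le_mul (Real.sqrt_le_sqrt hRν) hc2 (Real.sqrt_nonneg _) (Real.sqrt_nonneg _)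
    have k2 := mul_le_mul (Real.sqrt_le_sqrt hRμ) hc2 (Real.sqrt_nonneg _) (Real.sqrt_nonneg _)
    simp only [FR] at f1 f2
    linarith
  have hlim : α / 2 * W2 ρμ ρν ^ 2 ≤ 2 * Real.sqrt R * W2 μ ν := by
    have ht : Tendsto (fun s : ℝ => 2 * Real.sqrt R * (W2 μ ν + s)) (𝓝[>] 0)
        (𝓝 (2 * Real.sqrt R * (W2 μ ν + 0))) :=
      (Continuous.tendsto (by fun_prop) 0).mono_left nhdsWithin_le_nhds
    rw [add_zero] at ht
    exact ge_of_tendsto ht (by filter_upwards [self_mem_nhdsWithin] with s hs using key s hs)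
  rw [div_mul_eq_mul_div, le_div_iff₀ hα]
  linarith

end Stability

/-- quantitative stability of the minimizers of `F_μ` with respect to
the 2-Wasserstein distance. -/
theorem stmt5 (d : ℕ) (hd : 1 ≤ d) (α : ℝ) (hα : 0 < α) (M B : ℝ) (hM : 0 < M) (hB : 0 < B) :
    ∃ C : ℝ, 0 < C ∧
      ∀ μ ν : Measure (Ed d), μ ∈ P2 d → ν ∈ P2 d →
        Mp 2 μ ≤ M → Mp 2 ν ≤ M → ‖bary μ‖ < B → ‖bary ν‖ < B →
        ∀ ρμ ρν : Measure (Ed d), IsMinOfF α μ ρμ → IsMinOfF α ν ρν →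
          W2 ρμ ρν ≤ C * Real.sqrt (W2 μ ν) := by
  obtain ⟨R, hR, hbound⟩ := exists_m2_bound d hα M
  refine ⟨Real.sqrt (4 * Real.sqrt R / α), by positivity, ?_⟩
  intro μ ν hμ hν hMμ hMν _ _ ρμ ρν hρμ hρν
  rw [Mp_two] at hMμ hMν
  have h := W2_minimizers_sq_le hα hμ hν hρμ hρν (hbound μ ρμ hμ hMμ hρμ) (hbound ν ρν hν hMν hρν)
  rw [← Real.sqrt_mul (by positivity)]
  exact Real.le_sqrt_of_sq_le h
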